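/- arXiv:2411.03073 — 4 statements merged into one kernel-verified Lean document; each statement's English description precedes it below -/
import Mathlib

section
/- For every integer a ≥ 6 there exists an integer b with a < b and 1000·b ≤ 4374·(a−1) such that v_{a,b} < v_{a,b-1}. -/
open Finset

lemma Rat.not_dvd_den_add {p : ℕ} (hp : p.Prime) {x y : ℚ} (hx : ¬ p ∣ x.den)
    (hy : ¬ p ∣ y.den) : ¬ p ∣ (x + y).den := fun h ↦
  (hp.dvd_mul.1 (h.trans (Rat.add_den_dvd x y))).elim hx hy

lemma Rat.not_dvd_den_mul {p : ℕ} (hp : p.Prime) {x y : ℚ} (hx : ¬ p ∣ x.den)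
    (hy : ¬ p ∣ y.den) : ¬ p ∣ (x * y).den := fun h ↦
  (hp.dvd_mul.1 (h.trans (Rat.mul_den_dvd x y))).elim hx hy

lemma Rat.not_dvd_den_sum {ι : Type*} {p : ℕ} (hp : p.Prime) {s : Finset ι} {f : ι → ℚ}
    (h : ∀ i ∈ s, ¬ p ∣ (f i).den) : ¬ p ∣ (∑ i ∈ s, f i).den :=
  Finset.sum_induction f (fun x ↦ ¬ p ∣ x.den) (fun _ _ ↦ Rat.not_dvd_den_add hp)
    (by simpa using hp.ne_one) h

lemma Rat.not_dvd_den_one_div {p n : ℕ} (hn : ¬ p ∣ n) :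
    ¬ p ∣ ((1 : ℚ) / n).den := by
  have hn0 : n ≠ 0 := by rintro rfl; simp at hn
  simpa [Rat.inv_natCast_den, hn0] using hn

/-- The reciprocals of `p * j`, for `j` in an interval symmetric about `p / 2`, have a sum whose
denominator is prime to `p`. -/
lemma not_dvd_den_sum_one_div_mul {p m : ℕ} (hp : p.Prime) (hm : 1 ≤ m) (hmp : 2 * m < p) :
    ¬ p ∣ (∑ j ∈ Icc m (p - m), (1 : ℚ) / (p * j : ℕ)).den := by
  have hp0 : (p : ℚ) ≠ 0 := by exact_mod_cast hp.ne_zero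
  have hreflect : ∑ j ∈ Icc m (p - m), (1 : ℚ) / (p * j : ℕ) =
      ∑ j ∈ Icc m (p - m), (1 : ℚ) / (p * (p - j) : ℕ) := by
    refine sum_nbij' (fun j ↦ p - j) (fun j ↦ p - j) ?_ ?_ ?_ ?_ ?_ <;> intro j hj <;>
      rw [mem_Icc] at hj
    · rw [mem_Icc]; omega
    · rw [mem_Icc]; omega
    · omega
    · omega
    · rw [Nat.sub_sub_self (by omega)]
  have hsum : ∑ j ∈ Icc m (p - m), (1 : ℚ) / (p * j : ℕ) =
      (1 : ℚ) / (2 : ℕ) * ∑ j ∈ Icc m (p - m), (1 : ℚ) / (j * (p - j) : ℕ) := by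
    have key : ∑ j ∈ Icc m (p - m), (1 : ℚ) / (p * j : ℕ) +
        ∑ j ∈ Icc m (p - m), (1 : ℚ) / (p * (p - j) : ℕ) =
        ∑ j ∈ Icc m (p - m), (1 : ℚ) / (j * (p - j) : ℕ) := by
      rw [← sum_add_distrib]
      refine sum_congr rfl fun j hj ↦ ?_
      rw [mem_Icc] at hj
      have hjp : j < p := by omega
      have hj0 : (j : ℚ) ≠ 0 := by
        have : j ≠ 0 := by omega
        exact_mod_cast this
      have hpj : (p : ℚ) - j ≠ 0 := sub_ne_zero.2 (by exact_mod_cast hjp.ne')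
      push_cast [Nat.cast_sub hjp.le]
      field_simp
      ring
    rw [← key, ← hreflect]
    push_cast
    ring
  rw [hsum]
  refine Rat.not_dvd_den_mul hp (Rat.not_dvd_den_one_div fun h ↦ ?_)
    (Rat.not_dvd_den_sum hp fun j hj ↦ Rat.not_dvd_den_one_div fun h ↦ ?_)
  · have := Nat.le_of_dvd two_pos h
    omega
  · rw [mem_Icc] at hj
    rcases hp.dvd_mul.1 h with h | h
    · have := Nat.le_of_dvd (by omega) h
      omega
    · have := Nat.le_of_dvd (by omega) h
      omega

lemma not_dvd_den_sum_Icc_one_div {p m a : ℕ} (hp : p.Prime) (hm : 1 ≤ m) (hmp : 2 * m < p)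
    (ha : p * (m - 1) < a) (ha' : a ≤ p * m) :
    ¬ p ∣ (∑ i ∈ Icc a (p * (p - m)), (1 : ℚ) / i).den := by
  rw [← sum_filter_add_sum_filter_not _ (p ∣ ·)]
  refine Rat.not_dvd_den_add hp ?_ (Rat.not_dvd_den_sum hp fun i hi ↦
    Rat.not_dvd_den_one_div (mem_filter.1 hi).2)
  convert not_dvd_den_sum_one_div_mul hp hm hmp using 3
  refine (sum_nbij (p * ·) (fun j hj ↦ ?_) (fun j _ k _ h ↦ ?_) (fun i hi ↦ ?_)
    fun _ _ ↦ rfl).symm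
  · rw [mem_Icc] at hj
    rw [mem_filter, mem_Icc]
    exact ⟨⟨ha'.trans (Nat.mul_le_mul_left p hj.1), Nat.mul_le_mul_left p hj.2⟩,
      dvd_mul_right p j⟩
  · exact Nat.eq_of_mul_eq_mul_left hp.pos h
  · rw [mem_coe, mem_filter, mem_Icc] at hi
    obtain ⟨⟨h1, h2⟩, j, rfl⟩ := hi
    refine ⟨j, ?_, rfl⟩
    rw [mem_coe, mem_Icc]
    have h3 := Nat.lt_of_mul_lt_mul_left (ha.trans_le h1)
    have h4 := Nat.le_of_mul_le_mul_left h2 hp.pos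
    omega

/-- If adding `1 / (p * c)` with `c < p` removes the prime `p` from the denominator, then the
denominator gets smaller. -/
lemma Rat.den_add_one_div_lt {p c : ℕ} (hp : p.Prime) (hc : 0 < c) (hcp : c < p) {x : ℚ}
    (h : ¬ p ∣ (x + 1 / (p * c : ℕ)).den) : (x + 1 / (p * c : ℕ)).den < x.den := by
  have hx : p ∣ x.den := by
    by_contra hx
    have hsub : (1 : ℚ) / (p * c : ℕ) = (x + 1 / (p * c : ℕ)) + -x := by ring
    have hden : ((1 : ℚ) / (p * c : ℕ)).den = p * c := by
      have : p * c ≠ 0 := (Nat.mul_pos hp.pos hc).ne'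
      rw [one_div, Rat.inv_natCast_den, if_neg this]
    refine Rat.not_dvd_den_add hp h (y := -x) (by simpa using hx) ?_
    rw [← hsub, hden]
    exact dvd_mul_right p c
  obtain ⟨d, hd⟩ := hx
  have hd0 : 0 < d := Nat.pos_of_ne_zero fun h0 ↦ x.den_ne_zero (by simp [hd, h0])
  have hdvd : (x + 1 / (p * c : ℕ)).den ∣ p * (d * c) := by
    refine (Rat.add_den_dvd_lcm x _).trans (Nat.lcm_dvd ?_ ?_)
    · exact ⟨c, by rw [hd]; ring⟩
    · have : p * c ≠ 0 := (Nat.mul_pos hp.pos hc).ne'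
      rw [one_div, Rat.inv_natCast_den, if_neg this]
      exact ⟨d, by ring⟩
  have hdvd' := (Nat.Coprime.symm ((Nat.Prime.coprime_iff_not_dvd hp).2 h)).dvd_of_dvd_mul_left hdvd
  calc (x + 1 / (p * c : ℕ)).den ≤ d * c := Nat.le_of_dvd (Nat.mul_pos hd0 hc) hdvd'
    _ < d * p := Nat.mul_lt_mul_of_pos_left hcp hd0
    _ = x.den := by rw [hd, mul_comm]

lemma den_sum_Icc_one_div_lt {p m a : ℕ} (hp : p.Prime) (hm : 1 ≤ m) (hmp : 2 * m < p)
    (ha : p * (m - 1) < a) (ha' : a ≤ p * m) :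
    a < p * (p - m) ∧ (∑ i ∈ Icc a (p * (p - m)), (1 : ℚ) / i).den <
      (∑ i ∈ Icc a (p * (p - m) - 1), (1 : ℚ) / i).den := by
  have hlt : a < p * (p - m) :=
    ha'.trans_lt (Nat.mul_lt_mul_of_pos_left (by omega) hp.pos)
  refine ⟨hlt, ?_⟩
  have h := not_dvd_den_sum_Icc_one_div hp hm hmp ha ha'
  have hsum : ∑ i ∈ Icc a (p * (p - m)), (1 : ℚ) / i =
      ∑ i ∈ Icc a (p * (p - m) - 1), (1 : ℚ) / i + 1 / (p * (p - m) : ℕ) := by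
    obtain ⟨b, hb⟩ : ∃ b, p * (p - m) = b + 1 := ⟨p * (p - m) - 1, by omega⟩
    rw [hb, Nat.add_sub_cancel, sum_Icc_succ_top (by omega)]
  rw [hsum] at h ⊢
  exact Rat.den_add_one_div_lt hp (by omega) (by omega) h

lemma exists_den_drop_of_prime {p a : ℕ} (hp : p.Prime) (ha : 2 ≤ a) (hpa : 2 * a ≤ p * (p - 1))
    (hap : 1000 * p ^ 2 + 4374 ≤ 5374 * a) :
    ∃ b : ℕ, a < b ∧ 1000 * b ≤ 4374 * (a - 1) ∧
      (∑ i ∈ Icc a b, (1 : ℚ) / i).den < (∑ i ∈ Icc a (b - 1), (1 : ℚ) / i).den := by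
  obtain ⟨m, r, hr, rfl⟩ : ∃ m r, r < p ∧ a = p * m + r + 1 :=
    ⟨(a - 1) / p, (a - 1) % p, Nat.mod_lt _ hp.pos, by have := Nat.div_add_mod (a - 1) p; omega⟩
  have hm : 2 * m + 1 < p := by
    by_contra! h
    have h1 : p * (p - 1) ≤ p * (2 * m) := Nat.mul_le_mul_left p (by omega)
    have h2 : p * (2 * m) = 2 * (p * m) := by ring
    omega
  have hodd : 2 * (m + 1) < p := by
    rcases hp.eq_two_or_odd with rfl | h
    · omega
    · omega
  obtain ⟨h1, h2⟩ := den_sum_Icc_one_div_lt (a := p * m + r + 1) hp (Nat.le_add_left 1 m) hodd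
    (by rw [Nat.add_sub_cancel]; omega) (by rw [mul_add]; omega)
  refine ⟨_, h1, ?_, h2⟩
  have h3 : p * (p - (m + 1)) + p * (m + 1) = p ^ 2 := by
    rw [← mul_add, Nat.sub_add_cancel (by omega), sq]
  rw [mul_add] at h3
  omega

lemma factorial_mul_factorial_dvd_lcmUpto_mul (n : ℕ) :
    (30 * n).factorial * n.factorial ∣ Nat.lcmUpto (30 * n) *
      ((15 * n).factorial * (10 * n).factorial * (6 * n).factorial) := by
  have hf := Nat.factorial_ne_zero
  have hl := Nat.lcmUpto_ne_zero (30 * n)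
  have hr := mul_ne_zero (mul_ne_zero (hf (15 * n)) (hf (10 * n))) (hf (6 * n))
  rw [← Nat.factorization_prime_le_iff_dvd (mul_ne_zero (hf _) (hf _)) (mul_ne_zero hl hr)]
  intro p hp
  have hfac : ∀ k ≤ 30 * n, k.factorial.factorization p =
      ∑ i ∈ Ico 1 (Nat.log p (30 * n) + 1), k / p ^ i := fun k hk ↦
    Nat.factorization_factorial hp (Nat.lt_succ_of_le (Nat.log_mono_right hk))
  simp only [Nat.factorization_mul (hf _) (hf _), Nat.factorization_mul hl hr,
    Nat.factorization_mul (mul_ne_zero (hf (15 * n)) (hf (10 * n))) (hf (6 * n)),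
    Finsupp.add_apply, Nat.factorization_lcmUpto _ hp]
  rw [hfac _ le_rfl, hfac n (by omega), hfac (15 * n) (by omega), hfac (10 * n) (by omega),
    hfac (6 * n) (by omega), ← sum_add_distrib]
  refine le_of_le_of_eq (b := ∑ i ∈ Ico 1 (Nat.log p (30 * n) + 1),
    (1 + (15 * n / p ^ i + 10 * n / p ^ i + 6 * n / p ^ i))) ?_ (by simp [sum_add_distrib])
  refine sum_le_sum fun i _ ↦ ?_
  have h15 : 15 * n / p ^ i = 30 * n / p ^ i / 2 := by
    rw [Nat.div_right_comm]; congr 1; omega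
  have h10 : 10 * n / p ^ i = 30 * n / p ^ i / 3 := by
    rw [Nat.div_right_comm]; congr 1; omega
  have h6 : 6 * n / p ^ i = 30 * n / p ^ i / 5 := by
    rw [Nat.div_right_comm]; congr 1; omega
  have h1 : n / p ^ i = 30 * n / p ^ i / 30 := by
    rw [Nat.div_right_comm]; congr 1; omega
  omega

lemma log_factorial_le {n : ℕ} (hn : 1 ≤ n) :
    Real.log n.factorial ≤ n * Real.log n - n + Real.log n + 1 := by
  induction n, hn using Nat.le_induction with
  | base => simp
  | succ n hn ih =>
    have hn' : (0 : ℝ) < n := by exact_mod_cast hn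
    rw [Nat.factorial_succ]
    push_cast
    rw [Real.log_mul (by positivity) (by positivity)]
    have h := Real.one_sub_inv_le_log_of_pos (x := ((n : ℝ) + 1) / n) (by positivity)
    rw [Real.log_div (by positivity) (by positivity), inv_div] at h
    have h' : ((n : ℝ) + 1) * (1 - n / (n + 1)) = 1 := by field_simp; ring
    nlinarith [mul_le_mul_of_nonneg_left h (by positivity : (0 : ℝ) ≤ n + 1)]

lemma le_log_factorial (n : ℕ) : n * Real.log n - n ≤ Real.log n.factorial := by
  rcases Nat.eq_zero_or_pos n with rfl | hn
  · simp
  have hn' : (0 : ℝ) < n := by exact_mod_cast hn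
  have h := Real.log_le_log (by positivity) (Real.pow_div_factorial_le_exp (n : ℝ) hn'.le n)
  rw [Real.log_exp, Real.log_div (by positivity) (by positivity), Real.log_pow] at h
  linarith

/-- Chebyshev's lower bound for `ψ`, with a slightly weakened constant. -/
lemma le_psi_thirty_mul {n : ℕ} (hn : 1 ≤ n) :
    39.5 * Real.log 2 * n - 3 * Real.log (30 * n) - 3 ≤ Chebyshev.psi ((30 * n : ℕ) : ℝ) := by
  have hn' : (0 : ℝ) < n := by exact_mod_cast hn
  have hle := Nat.le_of_dvd (Nat.mul_pos (Nat.lcmUpto_pos _) (by positivity))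
    (factorial_mul_factorial_dvd_lcmUpto_mul n)
  have hl : (0 : ℝ) < Nat.lcmUpto (30 * n) := by exact_mod_cast Nat.lcmUpto_pos _
  have hlog := Real.log_le_log (by positivity) (Nat.cast_le (α := ℝ).2 hle)
  rw [Nat.cast_mul, Nat.cast_mul, Nat.cast_mul, Nat.cast_mul,
    Real.log_mul (by positivity) (by positivity), Real.log_mul (by positivity) (by positivity),
    Real.log_mul (by positivity) (by positivity), Real.log_mul (by positivity) (by positivity),
    ← Chebyshev.psi_eq_log_lcmUpto] at hlog
  have h30 := le_log_factorial (30 * n)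
  have h1 := le_log_factorial n
  have h15 := log_factorial_le (n := 15 * n) (by omega)
  have h10 := log_factorial_le (n := 10 * n) (by omega)
  have h6 := log_factorial_le (n := 6 * n) (by omega)
  have hm : ∀ k : ℕ, 0 < k → Real.log ((k * n : ℕ) : ℝ) = Real.log k + Real.log n := by
    intro k hk
    rw [Nat.cast_mul, Real.log_mul (by positivity) (by positivity)]
  have e30 : Real.log 30 = Real.log 2 + Real.log 3 + Real.log 5 := by
    rw [← Real.log_mul (by norm_num) (by norm_num), ← Real.log_mul (by norm_num) (by norm_num)]
    norm_num
  have e15 : Real.log 15 = Real.log 3 + Real.log 5 := by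
    rw [← Real.log_mul (by norm_num) (by norm_num)]; norm_num
  have e10 : Real.log 10 = Real.log 2 + Real.log 5 := by
    rw [← Real.log_mul (by norm_num) (by norm_num)]; norm_num
  have e6 : Real.log 6 = Real.log 2 + Real.log 3 := by
    rw [← Real.log_mul (by norm_num) (by norm_num)]; norm_num
  have hconst : 51 * Real.log 2 ≤ 18 * Real.log 3 + 10 * Real.log 5 := by
    have h := Real.log_le_log (x := 2 ^ 51) (y := 3 ^ 18 * 5 ^ 10) (by norm_num) (by norm_num)
    rw [Real.log_mul (by norm_num) (by norm_num), Real.log_pow, Real.log_pow, Real.log_pow] at h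
    exact_mod_cast h
  have l2 : 0 < Real.log 2 := Real.log_pos (by norm_num)
  have l3 : 0 < Real.log 3 := Real.log_pos (by norm_num)
  have l5 : 0 < Real.log 5 := Real.log_pos (by norm_num)
  rw [Real.log_mul (by norm_num) (by positivity), e30]
  rw [hm _ (by norm_num)] at h30 h15 h10 h6
  push_cast at *
  rw [e30] at h30
  rw [e15] at h15
  rw [e10] at h10
  rw [e6] at h6
  have hc := mul_le_mul_of_nonneg_right hconst hn'.le
  linarith

lemma sqrt_mul_log_lt {x : ℝ} (hx : 1000000 ≤ x) :
    4 * √x * Real.log √x + 6 * Real.log √x + 29 + 3 < 1 / 15 * 0.693 * x := by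
  have hx0 : 0 ≤ x := by linarith
  have hy : 1000 ≤ √x := Real.le_sqrt_of_sq_le (by linarith)
  have hsq := Real.sq_sqrt hx0
  set y := √x
  have h1000 : Real.log 1000 ≤ 7 := by
    have h := Real.log_le_log (x := 1000) (y := 2 ^ 10) (by norm_num) (by norm_num)
    rw [Real.log_pow] at h
    have := Real.log_two_lt_d9
    push_cast at h
    linarith
  have hlog : Real.log y ≤ 6 + y / 1000 := by
    have h := Real.log_le_sub_one_of_pos (x := y / 1000) (by positivity)
    rw [Real.log_div (by positivity) (by norm_num)] at h
    linarith
  rw [← hsq]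
  nlinarith [mul_le_mul_of_nonneg_left hlog (by positivity : 0 ≤ y)]

lemma theta_eq_of_forall_not_prime {x y : ℕ} (hxy : x ≤ y)
    (h : ∀ p, p.Prime → x < p → ¬ p ≤ y) : Chebyshev.theta (y : ℝ) = Chebyshev.theta (x : ℝ) := by
  simp only [Chebyshev.theta, Nat.floor_natCast]
  congr 1
  ext p
  simp only [mem_filter, mem_Ioc]
  refine ⟨fun ⟨⟨h0, h1⟩, h2⟩ ↦ ⟨⟨h0, ?_⟩, h2⟩, fun ⟨⟨h0, h1⟩, h2⟩ ↦ ⟨⟨h0, h1.trans hxy⟩, h2⟩⟩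
  by_contra! h3
  exact h p h2 h3 h1

lemma exists_prime_lt_and_le_of_large {x : ℕ} (hx : 1000000 ≤ x) :
    ∃ p, p.Prime ∧ x < p ∧ 5 * p ≤ 8 * x := by
  by_contra! hno
  set n := 8 * x / 150
  have hn1 : 150 * n ≤ 8 * x := Nat.mul_div_le _ _
  have hn2 : 8 * x < 150 * (n + 1) := by omega
  have hxn : x ≤ 30 * n := by omega
  have htheta := theta_eq_of_forall_not_prime hxn fun p hp hxp hle ↦
    absurd (hno p hp hxp) (by omega)
  have hup := Chebyshev.theta_le_log4_mul_x (x := x) (Nat.cast_nonneg x)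
  have hpsi := le_psi_thirty_mul (n := n) (by omega)
  have hn3 : (1000000 : ℝ) ≤ 30 * n := by exact_mod_cast hx.trans hxn
  have hdiff := Chebyshev.psi_sub_theta_le (x := (30 * n : ℕ)) (by push_cast; linarith)
  have hsmall := sqrt_mul_log_lt hn3
  rw [Real.log_sqrt (by linarith)] at hsmall
  have hlog4 : Real.log 4 = 2 * Real.log 2 := by
    rw [show (4 : ℝ) = 2 ^ 2 by norm_num, Real.log_pow]; norm_num
  have hl1 := Real.log_two_gt_d9
  have hl2 := Real.log_two_lt_d9
  have hn2' : 8 * (x : ℝ) < 150 * (n + 1) := by exact_mod_cast hn2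
  rw [htheta] at hdiff
  rw [hlog4] at hup
  push_cast at hdiff hpsi
  have h1 : Real.log 2 * (8 * (x : ℝ)) ≤ Real.log 2 * (150 * (n + 1)) :=
    mul_le_mul_of_nonneg_left hn2'.le (by linarith)
  have h2 : 0.693 * (n : ℝ) ≤ Real.log 2 * n :=
    mul_le_mul_of_nonneg_right (by linarith) (by positivity)
  linarith

lemma exists_prime_lt_and_le_step {x : ℕ} (q : ℕ) {p : ℕ} (hp : p.Prime) (hq : 5 * p ≤ 8 * q)
    (H : x < q → ∃ p, p.Prime ∧ x < p ∧ 5 * p ≤ 8 * x) (hx : x < p) :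
    ∃ p, p.Prime ∧ x < p ∧ 5 * p ≤ 8 * x := by
  by_cases h : x < q
  · exact H h
  · exact ⟨p, hp, hx, by omega⟩

/-- A sharpening of Bertrand's postulate. -/
lemma exists_prime_lt_and_le_eight_fifths {x : ℕ} (hx : 29 ≤ x) :
    ∃ p, p.Prime ∧ x < p ∧ 5 * p ≤ 8 * x := by
  by_cases h : 1000000 ≤ x
  · exact exists_prime_lt_and_le_of_large h
  replace h : x < 1194407 := by omega
  revert h
  refine exists_prime_lt_and_le_step 746509 (p := 1194407) (by norm_num) (by norm_num) ?_
  refine exists_prime_lt_and_le_step 466579 (p := 746509) (by norm_num) (by norm_num) ?_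
  refine exists_prime_lt_and_le_step 291619 (p := 466579) (by norm_num) (by norm_num) ?_
  refine exists_prime_lt_and_le_step 182279 (p := 291619) (by norm_num) (by norm_num) ?_
  refine exists_prime_lt_and_le_step 113933 (p := 182279) (by norm_num) (by norm_num) ?_
  refine exists_prime_lt_and_le_step 71209 (p := 113933) (by norm_num) (by norm_num) ?_
  refine exists_prime_lt_and_le_step 44519 (p := 71209) (by norm_num) (by norm_num) ?_
  refine exists_prime_lt_and_le_step 27827 (p := 44519) (by norm_num) (by norm_num) ?_
  refine exists_prime_lt_and_le_step 17401 (p := 27827) (by norm_num) (by norm_num) ?_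
  refine exists_prime_lt_and_le_step 10883 (p := 17401) (by norm_num) (by norm_num) ?_
  refine exists_prime_lt_and_le_step 6803 (p := 10883) (by norm_num) (by norm_num) ?_
  refine exists_prime_lt_and_le_step 4259 (p := 6803) (by norm_num) (by norm_num) ?_
  refine exists_prime_lt_and_le_step 2663 (p := 4259) (by norm_num) (by norm_num) ?_
  refine exists_prime_lt_and_le_step 1669 (p := 2663) (by norm_num) (by norm_num) ?_
  refine exists_prime_lt_and_le_step 1051 (p := 1669) (by norm_num) (by norm_num) ?_
  refine exists_prime_lt_and_le_step 661 (p := 1051) (by norm_num) (by norm_num) ?_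
  refine exists_prime_lt_and_le_step 419 (p := 661) (by norm_num) (by norm_num) ?_
  refine exists_prime_lt_and_le_step 263 (p := 419) (by norm_num) (by norm_num) ?_
  refine exists_prime_lt_and_le_step 167 (p := 263) (by norm_num) (by norm_num) ?_
  refine exists_prime_lt_and_le_step 107 (p := 167) (by norm_num) (by norm_num) ?_
  refine exists_prime_lt_and_le_step 67 (p := 107) (by norm_num) (by norm_num) ?_
  refine exists_prime_lt_and_le_step 43 (p := 67) (by norm_num) (by norm_num) ?_
  refine exists_prime_lt_and_le_step 29 (p := 43) (by norm_num) (by norm_num) ?_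
  omega

lemma exists_prime_window {a : ℕ} (ha : 900 ≤ a) :
    ∃ p, p.Prime ∧ 2 * a ≤ p * (p - 1) ∧ 1000 * p ^ 2 + 4374 ≤ 5374 * a := by
  set s := Nat.sqrt (2 * a)
  have hs1 : s * s ≤ 2 * a := Nat.sqrt_le _
  have hs2 : 2 * a < (s + 1) * (s + 1) := Nat.lt_succ_sqrt _
  have hs : 42 ≤ s := Nat.le_sqrt.2 (by omega)
  obtain ⟨p, hp, hsp, hps⟩ := exists_prime_lt_and_le_eight_fifths (x := s + 1) (by omega)
  obtain ⟨k, rfl⟩ : ∃ k, p = k + 1 := ⟨p - 1, by omega⟩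
  refine ⟨k + 1, hp, ?_, ?_⟩
  · rw [Nat.add_sub_cancel]
    nlinarith
  · have h1 : (5 * (k + 1)) ^ 2 ≤ (8 * (s + 1)) ^ 2 := Nat.pow_le_pow_left hps 2
    nlinarith

theorem exists_denominator_drop_le_4374div1000_mul
    (a : ℕ) (ha : 6 ≤ a) :
    ∃ b : ℕ, a < b ∧ 1000 * b ≤ 4374 * (a - 1) ∧
      (∑ i ∈ Finset.Icc a b, (1 : ℚ) / i).den <
        (∑ i ∈ Finset.Icc a (b - 1), (1 : ℚ) / i).den := by
  by_cases hlarge : 900 ≤ a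
  · obtain ⟨p, hp, h1, h2⟩ := exists_prime_window hlarge
    exact exists_den_drop_of_prime hp (by omega) h1 h2
  by_cases h22 : a = 22
  · subst h22
    exact ⟨54, by norm_num, by norm_num, by norm_num [Finset.sum_Icc_succ_top]⟩
  by_cases h23 : a = 23
  · subst h23
    exact ⟨54, by norm_num, by norm_num, by norm_num [Finset.sum_Icc_succ_top]⟩
  have of_prime (p : ℕ) (hp : p.Prime) (h1 : 2 * a ≤ p * (p - 1))
      (h2 : 1000 * p ^ 2 + 4374 ≤ 5374 * a) := exists_den_drop_of_prime hp (by omega) h1 h2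
  rcases le_or_gt a 10 with h | h
  · exact of_prime 5 (by norm_num) (by omega) (by omega)
  rcases le_or_gt a 21 with h | h
  · exact of_prime 7 (by norm_num) (by omega) (by omega)
  rcases le_or_gt a 55 with h | h
  · exact of_prime 11 (by norm_num) (by omega) (by omega)
  rcases le_or_gt a 136 with h | h
  · exact of_prime 17 (by norm_num) (by omega) (by omega)
  rcases le_or_gt a 253 with h | h
  · exact of_prime 23 (by norm_num) (by omega) (by omega)
  rcases le_or_gt a 406 with h | h
  · exact of_prime 29 (by norm_num) (by omega) (by omega)
  rcases le_or_gt a 903 with h | h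
  · exact of_prime 43 (by norm_num) (by omega) (by omega)
  omega
end

section
/- There exist a real constant c₀ > 0 and a natural number N such that for all integers n ≥ N, |X_n| > c₀ · n^{−t} · 2^{n/t}. -/
open Finset

/-- `Lab r a b` is the least common multiple of those `i ∈ {a,…,b}` with `r i ≠ 0`
(equal to `1` if there are none). -/
def Lab (r : ℕ → ℤ) (a b : ℕ) : ℕ :=
  ((Finset.Icc a b).filter fun i => r i ≠ 0).lcm id

/-- `Xab r a b = L_{a,b} · Σ_{i=a}^b r_i / i`, as an integer. -/
def Xab (r : ℕ → ℤ) (a b : ℕ) : ℤ :=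
  ∑ i ∈ Finset.Icc a b, r i * ((Lab r a b / i : ℕ) : ℤ)


theorem dvd_Lab {r : ℕ → ℤ} {a b i : ℕ} (ha : a ≤ i) (hb : i ≤ b) (hi : r i ≠ 0) :
    i ∣ Lab r a b :=
  Finset.dvd_lcm (f := id) (by simp [ha, hb, hi])

theorem Lab_pos {r : ℕ → ℤ} {b : ℕ} : 0 < Lab r 1 b := by
  refine Nat.pos_of_ne_zero fun h => ?_
  rw [Lab, Finset.lcm_eq_zero_iff] at h
  simp at h

theorem Xab_one_eq_Lab_mul_sum (r : ℕ → ℤ) (n : ℕ) :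
    (Xab r 1 n : ℝ) = Lab r 1 n * ∑ i ∈ Finset.Icc 1 n, (r i : ℝ) / i := by
  rw [Xab, Int.cast_sum, Finset.mul_sum]
  refine Finset.sum_congr rfl fun i hi => ?_
  obtain ⟨h1, h2⟩ := Finset.mem_Icc.1 hi
  by_cases h : r i = 0
  · simp [h]
  · have h0 : (i : ℝ) ≠ 0 := by positivity
    rw [Int.cast_mul, Int.cast_natCast, Nat.cast_div (dvd_Lab h1 h2 h) h0]
    ring

/-- A common multiple of the terms of an arithmetic progression, multiplied by `m! * t ^ m`, is a
multiple of their product. -/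
theorem exists_int_eq_mul_div_prod (L a t : ℕ) (ha : 1 ≤ a) (m : ℕ) : ∀ s : ℕ,
    (∀ j, s ≤ j → j ≤ s + m → a + j * t ∣ L) →
    ∃ z : ℤ, (z : ℚ) = L * m.factorial * t ^ m /
      ∏ i ∈ Finset.range (m + 1), ((a : ℚ) + (s + i : ℕ) * t) := by
  have hpos : ∀ k : ℕ, (a : ℚ) + k * t ≠ 0 := fun k => by positivity
  induction m with
  | zero =>
    intro s h
    obtain ⟨q, hq⟩ := h s le_rfl le_rfl
    refine ⟨q, ?_⟩
    have := hpos s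
    simp only [Nat.factorial, zero_add, Finset.prod_range_one, add_zero, pow_zero, mul_one,
      Nat.cast_one]
    rw [eq_div_iff this, hq]
    push_cast
    ring
  | succ m ih =>
    intro s h
    obtain ⟨x, hx⟩ := ih s fun j h1 h2 => h j h1 (by omega)
    obtain ⟨y, hy⟩ := ih (s + 1) fun j h1 h2 => h j (by omega) (by omega)
    refine ⟨x - y, ?_⟩
    rw [Int.cast_sub, hx, hy, Finset.prod_range_succ _ (m + 1), Finset.prod_range_succ' _ m,
      Finset.prod_range_succ _ m]
    have e : ∀ i, s + 1 + i = s + (i + 1) := fun i => by omega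
    simp only [e, add_zero]
    have hQ : ∏ i ∈ Finset.range m, ((a : ℚ) + (s + (i + 1) : ℕ) * t) ≠ 0 :=
      Finset.prod_ne_zero_iff.2 fun i _ => hpos _
    have h1 := hpos s
    have h2 := hpos (s + (m + 1))
    generalize ∏ i ∈ Finset.range m, ((a : ℚ) + (s + (i + 1) : ℕ) * t) = Q at *
    rw [Nat.factorial_succ]
    push_cast at h2 ⊢
    field_simp
    ring

theorem prod_le_mul_factorial_mul_pow (L a t : ℕ) (ha : 1 ≤ a) (ht : 1 ≤ t) (hL : 0 < L)
    (m s : ℕ) (h : ∀ j, s ≤ j → j ≤ s + m → a + j * t ∣ L) :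
    ∏ i ∈ Finset.range (m + 1), (a + (s + i) * t) ≤ L * m.factorial * t ^ m := by
  obtain ⟨z, hz⟩ := exists_int_eq_mul_div_prod L a t ha m s h
  have hP : 0 < ∏ i ∈ Finset.range (m + 1), ((a : ℚ) + (s + i : ℕ) * t) :=
    Finset.prod_pos fun i _ => by positivity
  have hz0 : (0 : ℚ) < z := by
    rw [hz]
    have := m.factorial_pos
    positivity
  have hz1 : (1 : ℚ) ≤ z := by
    have : 0 < z := by exact_mod_cast hz0
    exact_mod_cast this
  rw [hz, le_div_iff₀ hP, one_mul] at hz1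
  exact_mod_cast hz1

theorem four_pow_le_two_mul_of_dvd (L a t k : ℕ) (ha : 1 ≤ a) (ht : 1 ≤ t) (hL : 0 < L)
    (h : ∀ j, j ≤ 2 * k → a + j * t ∣ L) : 4 ^ k ≤ 2 * L := by
  rcases Nat.eq_zero_or_pos k with rfl | hk
  · simp; omega
  have h1 := prod_le_mul_factorial_mul_pow L a t ha ht hL k k fun j _ hj => h j (by omega)
  have h2 : ∏ i ∈ Finset.range (k + 1), ((k + i) * t) ≤
      ∏ i ∈ Finset.range (k + 1), (a + (k + i) * t) :=
    Finset.prod_le_prod' fun i _ => by omega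
  rw [Finset.prod_mul_distrib, Finset.prod_const, Finset.card_range,
    ← Nat.ascFactorial_eq_prod_range] at h2
  have h3 : k.ascFactorial (k + 1) = k * (k.factorial * k.centralBinom) := by
    rw [Nat.ascFactorial_succ, ← Nat.succ_ascFactorial, Nat.succ_eq_add_one,
      Nat.ascFactorial_eq_factorial_mul_choose, Nat.centralBinom, two_mul]
  have h4 := Nat.four_pow_le_two_mul_self_mul_centralBinom k hk
  have h5 : (k.factorial * t ^ k) * (k * k.centralBinom * t) ≤ (k.factorial * t ^ k) * L := by
    calc _ = k.ascFactorial (k + 1) * t ^ (k + 1) := by rw [h3]; ring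
      _ ≤ _ := h2.trans h1
      _ = _ := by ring
  have h6 := Nat.le_of_mul_le_mul_left h5 (by have := k.factorial_pos; positivity)
  have h7 : k * k.centralBinom * 1 ≤ k * k.centralBinom * t := Nat.mul_le_mul_left _ ht
  calc 4 ^ k ≤ 2 * k * k.centralBinom := h4
    _ = 2 * (k * k.centralBinom) := by ring
    _ ≤ _ := by omega

theorem exists_mul_two_rpow_le_Lab (t : ℕ) (r : ℕ → ℤ) (ht : 1 ≤ t)
    (hper : ∀ i, 1 ≤ i → r (i + t) = r i) (hnz : ∃ i, 1 ≤ i ∧ r i ≠ 0) :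
    ∃ c : ℝ, 0 < c ∧ ∃ N : ℕ, ∀ n : ℕ, N ≤ n →
      c * (2 : ℝ) ^ ((n : ℝ) / t) ≤ Lab r 1 n := by
  obtain ⟨a, ha, hra⟩ := hnz
  have hr : ∀ j, r (a + j * t) ≠ 0 := by
    intro j
    induction j with
    | zero => simpa
    | succ j ih =>
      rw [Nat.succ_mul, ← add_assoc, hper _ (by omega)]
      exact ih
  have ht0 : (0 : ℝ) < t := by exact_mod_cast ht
  refine ⟨((2 : ℝ) ^ ((a : ℝ) / t + 3))⁻¹, by positivity, a, fun n hn => ?_⟩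
  set k := (n - a) / (2 * t) with hk
  have hk1 : k * (2 * t) ≤ n - a := Nat.div_mul_le_self _ _
  have hk2 : n - a < (k + 1) * (2 * t) := by
    rw [add_mul, one_mul]
    exact Nat.lt_div_mul_add (by omega)
  have h4 : 4 ^ k ≤ 2 * Lab r 1 n := by
    refine four_pow_le_two_mul_of_dvd _ a t k ha ht Lab_pos fun j hj => ?_
    refine dvd_Lab (by omega) ?_ (hr j)
    have : j * t ≤ 2 * k * t := Nat.mul_le_mul_right _ hj
    nlinarith [Nat.sub_add_cancel hn]
  have h4' : (4 : ℝ) ^ k ≤ 2 * Lab r 1 n := by exact_mod_cast h4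
  have hle : (n : ℝ) / t ≤ a / t + 2 + (2 * k : ℕ) := by
    have : (n : ℝ) ≤ a + (k + 1) * (2 * t) := by
      have : n ≤ a + (k + 1) * (2 * t) := by omega
      exact_mod_cast this
    rw [div_le_iff₀ ht0]
    push_cast
    have e : ((a : ℝ) / t + 2 + 2 * k) * t = a / t * t + (k + 1) * (2 * t) := by ring
    rw [e, div_mul_cancel₀ _ ht0.ne']
    exact this
  have h5 : (2 : ℝ) ^ ((n : ℝ) / t) ≤ 2 ^ ((a : ℝ) / t + 2) * 4 ^ k := by
    calc (2 : ℝ) ^ ((n : ℝ) / t) ≤ 2 ^ ((a : ℝ) / t + 2 + (2 * k : ℕ)) :=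
          Real.rpow_le_rpow_of_exponent_le (by norm_num) hle
      _ = _ := by
          rw [Real.rpow_add (by norm_num), Real.rpow_natCast, pow_mul]
          norm_num
  have h6 : (2 : ℝ) ^ ((a : ℝ) / t + 3) = 2 ^ ((a : ℝ) / t + 2) * 2 := by
    rw [show (a : ℝ) / t + 3 = (a / t + 2) + 1 by ring, Real.rpow_add_one (by norm_num)]
  rw [inv_mul_le_iff₀ (by positivity), h6, mul_assoc]
  exact h5.trans (mul_le_mul_of_nonneg_left h4' (by positivity))

theorem eventually_one_le_eval (P : Polynomial ℤ) (hP : 0 < P.leadingCoeff) :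
    ∀ᶠ n : ℕ in Filter.atTop, 1 ≤ P.eval (n : ℤ) := by
  rcases le_or_gt P.degree 0 with h | h
  · rw [Polynomial.eq_C_of_degree_le_zero h] at hP ⊢
    rw [Polynomial.leadingCoeff_C] at hP
    refine Filter.Eventually.of_forall fun _ => ?_
    rw [Polynomial.eval_C]
    exact hP
  · have hinj : Function.Injective (Int.castRingHom ℝ) := Int.cast_injective
    have key := (P.map (Int.castRingHom ℝ)).tendsto_atTop_of_leadingCoeff_nonneg
      (by rwa [Polynomial.degree_map_eq_of_injective hinj])
      (by
        rw [Polynomial.leadingCoeff_map_of_injective hinj]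
        exact Int.cast_nonneg hP.le)
    filter_upwards [(key.comp tendsto_natCast_atTop_atTop).eventually_ge_atTop 1] with n hn
    have e : (P.map (Int.castRingHom ℝ)).eval (n : ℝ) = (P.eval (n : ℤ) : ℤ) := by
      simpa only [eq_intCast, Int.cast_natCast] using
        Polynomial.eval_map_apply (p := P) (f := Int.castRingHom ℝ) (n : ℤ)
    rw [Function.comp_apply, e] at hn
    exact_mod_cast hn

theorem eventually_one_le_eval_or_le_neg_one (P : Polynomial ℤ) (hP : P ≠ 0) :
    (∀ᶠ n : ℕ in Filter.atTop, 1 ≤ P.eval (n : ℤ)) ∨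
      ∀ᶠ n : ℕ in Filter.atTop, P.eval (n : ℤ) ≤ -1 := by
  rcases lt_or_gt_of_ne (Polynomial.leadingCoeff_ne_zero.2 hP) with h | h
  · right
    filter_upwards [eventually_one_le_eval (-P) (by simpa using h)] with n hn
    rw [Polynomial.eval_neg] at hn
    omega
  · exact .inl (eventually_one_le_eval P h)

/-- An eventually strictly increasing sequence stays away from zero, up to its increments. -/
theorem exists_min_sub_le_abs (f : ℕ → ℝ) (M : ℕ) (h : ∀ m, M ≤ m → f m < f (m + 1)) :
    ∃ c : ℝ, 0 < c ∧ ∃ N : ℕ, ∀ m, N ≤ m → min c (f (m + 1) - f m) ≤ |f m| := by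
  have hmono : ∀ m k, M ≤ m → f m ≤ f (m + k) := by
    intro m k hm
    induction k with
    | zero => simp
    | succ k ih => exact ih.trans (h (m + k) (by omega)).le
  by_cases hp : ∃ m, M ≤ m ∧ 0 < f m
  · obtain ⟨m₀, hm₀, hf⟩ := hp
    refine ⟨f m₀, hf, m₀, fun m hm => ?_⟩
    obtain ⟨k, rfl⟩ := Nat.exists_eq_add_of_le hm
    exact (min_le_left _ _).trans ((hmono m₀ k hm₀).trans (le_abs_self _))
  · push Not at hp
    refine ⟨1, one_pos, M, fun m hm => (min_le_right _ _).trans ?_⟩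
    have := hp (m + 1) (by omega)
    have := neg_le_abs (f m)
    linarith

section PartialSums

variable (r : ℕ → ℤ)

theorem sum_Icc_add_div (n u : ℕ) :
    ∑ i ∈ Finset.Icc 1 (n + u), (r i : ℝ) / i = ∑ i ∈ Finset.Icc 1 n, (r i : ℝ) / i +
      ∑ l ∈ Finset.Icc 1 u, (r (n + l) : ℝ) / ((n : ℝ) + l) := by
  induction u with
  | zero => simp
  | succ u ih =>
    rw [← add_assoc, Finset.sum_Icc_succ_top (by omega), Finset.sum_Icc_succ_top (by omega), ih]
    push_cast
    ring_nf

/-- The numerator of `∑ l ∈ {1,…,t}, r (j + l) / (X + l)` over the denominator `∏ (X + l)`. -/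
noncomputable def blockNumerator (t j : ℕ) : Polynomial ℤ :=
  ∑ l ∈ Finset.Icc 1 t, Polynomial.C (r (j + l)) *
    ∏ i ∈ (Finset.Icc 1 t).erase l, (Polynomial.X + Polynomial.C (i : ℤ))

theorem sum_div_eq_blockNumerator_div (t j n : ℕ) :
    ∑ l ∈ Finset.Icc 1 t, (r (j + l) : ℝ) / ((n : ℝ) + l) =
      ((blockNumerator r t j).eval (n : ℤ) : ℤ) / ∏ l ∈ Finset.Icc 1 t, ((n : ℝ) + l) := by
  have hpos : ∀ l ∈ Finset.Icc 1 t, ((n : ℝ) + l) ≠ 0 := fun l hl => by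
    have := (Finset.mem_Icc.1 hl).1
    positivity
  rw [eq_div_iff (Finset.prod_ne_zero_iff.2 hpos), Finset.sum_mul, blockNumerator,
    Polynomial.eval_finsetSum, Int.cast_sum]
  refine Finset.sum_congr rfl fun l hl => ?_
  rw [← Finset.mul_prod_erase _ _ hl, Polynomial.eval_mul, Polynomial.eval_prod]
  have := hpos l hl
  simp
  field_simp

theorem blockNumerator_ne_zero {t j l : ℕ} (hl : l ∈ Finset.Icc 1 t) (hr : r (j + l) ≠ 0) :
    blockNumerator r t j ≠ 0 := by
  intro h
  have h0 : (blockNumerator r t j).eval (-(l : ℤ)) = 0 := by rw [h, Polynomial.eval_zero]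
  rw [blockNumerator, Polynomial.eval_finsetSum, Finset.sum_eq_single_of_mem l hl] at h0
  · rw [Polynomial.eval_mul, Polynomial.eval_C, Polynomial.eval_prod, mul_eq_zero,
      Finset.prod_eq_zero_iff] at h0
    rcases h0 with h0 | ⟨i, hi, h0⟩
    · exact hr h0
    · have := (Finset.mem_erase.1 hi).1
      simp at h0
      omega
  · intro b _ hbl
    rw [Polynomial.eval_mul, Polynomial.eval_prod,
      Finset.prod_eq_zero (Finset.mem_erase.2 ⟨hbl.symm, hl⟩) (by simp), mul_zero]

variable {r}

theorem exists_mem_Icc_add_ne_zero {t : ℕ} (ht : 1 ≤ t) (hper : ∀ i, 1 ≤ i → r (i + t) = r i)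
    (hnz : ∃ i, 1 ≤ i ∧ r i ≠ 0) (j : ℕ) : ∃ l ∈ Finset.Icc 1 t, r (j + l) ≠ 0 := by
  induction j with
  | zero =>
    by_contra! h
    obtain ⟨i, hi, hri⟩ := hnz
    refine hri ?_
    clear hri
    induction i using Nat.strong_induction_on with
    | _ i ih =>
      by_cases hit : i ≤ t
      · simpa using h i (by simp [hi, hit])
      · rw [← Nat.sub_add_cancel (by omega : t ≤ i), hper _ (by omega)]
        exact ih _ (by omega) (by omega)
  | succ j ih =>
    obtain ⟨l, hl, hr⟩ := ih
    rw [Finset.mem_Icc] at hl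
    by_cases h1 : l = 1
    · refine ⟨t, by simp [ht], ?_⟩
      rw [hper _ (by omega), ← h1]
      exact hr
    · refine ⟨l - 1, by simp; omega, ?_⟩
      rwa [show j + 1 + (l - 1) = j + l by omega]

theorem exists_mul_rpow_le_abs_sum_of_mod_eq {t : ℕ} (ht : 1 ≤ t)
    (hper : ∀ i, 1 ≤ i → r (i + t) = r i) (hnz : ∃ i, 1 ≤ i ∧ r i ≠ 0) (j : ℕ) :
    ∃ c : ℝ, 0 < c ∧ ∃ N : ℕ, ∀ n : ℕ, N ≤ n → n % t = j →
      c * (n : ℝ) ^ (-(t : ℝ)) ≤ |∑ i ∈ Finset.Icc 1 n, (r i : ℝ) / i| := by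
  set S : ℕ → ℝ := fun n => ∑ i ∈ Finset.Icc 1 n, (r i : ℝ) / i with hS
  have hperm : ∀ m l, 1 ≤ l → r (j + m * t + l) = r (j + l) := by
    intro m l hl
    induction m with
    | zero => simp
    | succ m ih => rw [← ih, ← hper (j + m * t + l) (by omega)]; congr 1; ring
  have hstep : ∀ m, S (j + (m + 1) * t) - S (j + m * t) =
      ((blockNumerator r t j).eval ((j + m * t : ℕ) : ℤ) : ℤ) /
        ∏ l ∈ Finset.Icc 1 t, (((j + m * t : ℕ) : ℝ) + l) := by
    intro m
    rw [← sum_div_eq_blockNumerator_div, add_mul, one_mul, ← add_assoc, hS]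
    simp only
    rw [sum_Icc_add_div, add_sub_cancel_left]
    exact Finset.sum_congr rfl fun l hl => by rw [hperm m l (Finset.mem_Icc.1 hl).1]
  have hprod : ∀ n : ℕ, 0 < ∏ l ∈ Finset.Icc 1 t, ((n : ℝ) + l) := fun n =>
    Finset.prod_pos fun l hl => by
      have := (Finset.mem_Icc.1 hl).1
      positivity
  have hprod_le : ∀ n : ℕ, 1 ≤ n → ∏ l ∈ Finset.Icc 1 t, ((n : ℝ) + l) ≤
      (t + 1 : ℝ) ^ t * (n : ℝ) ^ t := by
    intro n hn
    have hn' : (1 : ℝ) ≤ n := by exact_mod_cast hn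
    rw [← mul_pow]
    calc ∏ l ∈ Finset.Icc 1 t, ((n : ℝ) + l) ≤ ∏ l ∈ Finset.Icc 1 t, ((t + 1 : ℝ) * n) := by
          refine Finset.prod_le_prod (fun l _ => by positivity) fun l hl => ?_
          have : (l : ℝ) ≤ t := by exact_mod_cast (Finset.mem_Icc.1 hl).2
          nlinarith
      _ = _ := by simp
  -- The increments along the residue class all have the sign `ε` and are not too small.
  obtain ⟨ε, hε, M, hM⟩ : ∃ ε : ℝ, |ε| = 1 ∧ ∃ M : ℕ, ∀ n : ℕ, M ≤ n →
      1 ≤ ε * ((blockNumerator r t j).eval (n : ℤ) : ℤ) := by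
    obtain ⟨l, hl, hr⟩ := exists_mem_Icc_add_ne_zero ht hper hnz j
    rcases eventually_one_le_eval_or_le_neg_one _ (blockNumerator_ne_zero r hl hr) with h | h
    · obtain ⟨M, hM⟩ := Filter.eventually_atTop.1 h
      refine ⟨1, by simp, M, fun n hn => ?_⟩
      rw [one_mul]
      exact_mod_cast hM n hn
    · obtain ⟨M, hM⟩ := Filter.eventually_atTop.1 h
      refine ⟨-1, by simp, M, fun n hn => ?_⟩
      have := hM n hn
      have : (1 : ℤ) ≤ -1 * (blockNumerator r t j).eval (n : ℤ) := by omega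
      exact_mod_cast this
  have hincr : ∀ m, M ≤ m → 1 / ∏ l ∈ Finset.Icc 1 t, (((j + m * t : ℕ) : ℝ) + l) ≤
      ε * S (j + (m + 1) * t) - ε * S (j + m * t) := by
    intro m hm
    rw [← mul_sub, hstep, ← mul_div_assoc]
    exact div_le_div_of_nonneg_right (hM _ (by nlinarith)) (hprod _).le
  obtain ⟨c, hc, N, hN⟩ := exists_min_sub_le_abs (fun m => ε * S (j + m * t)) M fun m hm =>
    sub_pos.1 ((one_div_pos.2 (hprod _)).trans_le (hincr m hm))
  refine ⟨min c ((t + 1 : ℝ) ^ t)⁻¹, by positivity, j + (N + M + 1) * t, fun n hn hj => ?_⟩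
  obtain ⟨m, rfl⟩ : ∃ m, n = j + m * t := ⟨n / t, by rw [← hj]; exact (Nat.mod_add_div' n t).symm⟩
  have hm : N + M + 1 ≤ m := Nat.le_of_mul_le_mul_right (Nat.le_of_add_le_add_left hn) ht
  have h1 := hN m (by omega)
  have h2 := hincr m (by omega)
  rw [abs_mul, hε, one_mul] at h1
  have hn1 : 1 ≤ j + m * t := by nlinarith
  generalize j + m * t = n at *
  have hn' : (1 : ℝ) ≤ n := by exact_mod_cast hn1
  refine le_trans ?_ h1
  rw [Real.rpow_neg (by positivity), Real.rpow_natCast]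
  have hpow : (1 : ℝ) ≤ (n : ℝ) ^ t := one_le_pow₀ hn'
  refine le_min ?_ (le_trans ?_ h2)
  · calc _ ≤ c * ((n : ℝ) ^ t)⁻¹ := mul_le_mul_of_nonneg_right (min_le_left _ _) (by positivity)
      _ ≤ c * 1 := mul_le_mul_of_nonneg_left (inv_le_one_of_one_le₀ hpow) hc.le
      _ = c := mul_one c
  · calc _ ≤ ((t + 1 : ℝ) ^ t)⁻¹ * ((n : ℝ) ^ t)⁻¹ :=
          mul_le_mul_of_nonneg_right (min_le_right _ _) (by positivity)
      _ = 1 / ((t + 1 : ℝ) ^ t * (n : ℝ) ^ t) := by rw [one_div, mul_inv]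
      _ ≤ _ := one_div_le_one_div_of_le (hprod n) (hprod_le n hn1)

theorem exists_mul_rpow_le_abs_sum {t : ℕ} (ht : 1 ≤ t)
    (hper : ∀ i, 1 ≤ i → r (i + t) = r i) (hnz : ∃ i, 1 ≤ i ∧ r i ≠ 0) :
    ∃ c : ℝ, 0 < c ∧ ∃ N : ℕ, ∀ n : ℕ, N ≤ n →
      c * (n : ℝ) ^ (-(t : ℝ)) ≤ |∑ i ∈ Finset.Icc 1 n, (r i : ℝ) / i| := by
  have key : ∀ J : ℕ, ∃ c : ℝ, 0 < c ∧ ∃ N : ℕ, ∀ n : ℕ, N ≤ n → n % t < J →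
      c * (n : ℝ) ^ (-(t : ℝ)) ≤ |∑ i ∈ Finset.Icc 1 n, (r i : ℝ) / i| := by
    intro J
    induction J with
    | zero => exact ⟨1, one_pos, 0, fun n _ h => absurd h (Nat.not_lt_zero _)⟩
    | succ J ih =>
      obtain ⟨c, hc, N, hN⟩ := ih
      obtain ⟨c', hc', N', hN'⟩ := exists_mul_rpow_le_abs_sum_of_mod_eq ht hper hnz J
      refine ⟨min c c', lt_min hc hc', max N N', fun n hn h => ?_⟩
      rcases Nat.lt_succ_iff_lt_or_eq.1 h with h | h
      · exact (mul_le_mul_of_nonneg_right (min_le_left _ _) (by positivity)).trans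
          (hN n (le_of_max_le_left hn) h)
      · exact (mul_le_mul_of_nonneg_right (min_le_right _ _) (by positivity)).trans
          (hN' n (le_of_max_le_right hn) h)
  obtain ⟨c, hc, N, hN⟩ := key t
  exact ⟨c, hc, N, fun n hn => hN n hn (Nat.mod_lt _ ht)⟩

end PartialSums

/-- There exist `c₀ > 0` and `N` such that for all `n ≥ N`, `|X_n| > c₀ · n^(−t) · 2^(n/t)`. -/
theorem exists_exponential_lower_bound_Xn
    (t : ℕ) (r : ℕ → ℤ) (ht : 1 ≤ t)
    (hper : ∀ i, 1 ≤ i → r (i + t) = r i)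
    (hnz : ∃ i, 1 ≤ i ∧ r i ≠ 0) :
    ∃ c₀ : ℝ, 0 < c₀ ∧ ∃ N : ℕ, ∀ n : ℕ, N ≤ n →
      c₀ * (n : ℝ) ^ (-(t : ℝ)) * (2 : ℝ) ^ ((n : ℝ) / t) < |(Xab r 1 n : ℝ)| := by
  obtain ⟨c₁, hc₁, N₁, h₁⟩ := exists_mul_two_rpow_le_Lab t r ht hper hnz
  obtain ⟨c₂, hc₂, N₂, h₂⟩ := exists_mul_rpow_le_abs_sum ht hper hnz
  refine ⟨c₁ * c₂ / 2, by positivity, max (max N₁ N₂) 1, fun n hn => ?_⟩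
  have hn₁ := h₁ n (by omega)
  have hn₂ := h₂ n (by omega)
  have hn0 : (0 : ℝ) < n := by
    have : 0 < n := by omega
    exact_mod_cast this
  have hpos : 0 < (c₁ * (2 : ℝ) ^ ((n : ℝ) / t)) * (c₂ * (n : ℝ) ^ (-(t : ℝ))) := by positivity
  rw [Xab_one_eq_Lab_mul_sum, abs_mul, Nat.abs_cast]
  have := mul_le_mul hn₁ hn₂ (by positivity) (by positivity)
  linarith
end

section
/- For every integer M > max(r*, t) there exist an integer n ≥ i₁ and a prime p with p ≥ M such that p divides X_n. In particular, the set of primes dividing some X_n is unbounded. -/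
open Finset

/-- `r* = max_{1 ≤ i ≤ t} |r_i|`. -/
def rstar (r : ℕ → ℤ) (t : ℕ) : ℕ :=
  (Finset.Icc 1 t).sup fun i => (r i).natAbs

/-- The partial sums `∑_{i ≤ n} r_i / i`. -/
def partialSum (r : ℕ → ℤ) (n : ℕ) : ℚ := ∑ i ∈ Icc 1 n, (r i : ℚ) / i

/-- The numerator of `∑_{m < i ≤ n} r_i / i` over the common denominator `∏_{a < i ≤ b} i`. -/
def windowNumerator (r : ℕ → ℤ) (a b m n : ℕ) : ℤ :=
  ∑ i ∈ Ioc m n, r i * ∏ j ∈ (Ioc a b).erase i, (j : ℤ)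

lemma Lab_one_ne_zero (r : ℕ → ℤ) (n : ℕ) : Lab r 1 n ≠ 0 := by
  unfold Lab
  rw [Ne, Finset.lcm_eq_zero_iff]
  simp

lemma dvd_Lab_one {r : ℕ → ℤ} {i n : ℕ} (h1 : 1 ≤ i) (hin : i ≤ n) (hr : r i ≠ 0) :
    i ∣ Lab r 1 n :=
  Finset.dvd_lcm (f := id) (by simp [h1, hin, hr])

lemma Lab_one_dvd_Lab_one (r : ℕ → ℤ) {m n : ℕ} (h : m ≤ n) : Lab r 1 m ∣ Lab r 1 n := by
  refine Finset.lcm_dvd fun i hi => ?_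
  simp only [mem_filter, mem_Icc] at hi
  exact dvd_Lab_one hi.1.1 (hi.1.2.trans h) hi.2

lemma Xab_one_eq (r : ℕ → ℤ) (n : ℕ) :
    (Xab r 1 n : ℚ) = Lab r 1 n * partialSum r n := by
  unfold Xab partialSum
  rw [Int.cast_sum, Finset.mul_sum]
  refine Finset.sum_congr rfl fun i hi => ?_
  rw [mem_Icc] at hi
  by_cases hr : r i = 0
  · simp [hr]
  · rw [Int.cast_mul, Int.cast_natCast,
      Nat.cast_div (dvd_Lab_one hi.1 hi.2 hr) (Nat.cast_ne_zero.2 (by omega))]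
    ring

lemma Nat.Prime.pow_le_of_dvd_finset_lcm {p e n : ℕ} (hp : p.Prime) (hn : 1 ≤ n)
    (s : Finset ℕ) (hs : ∀ i ∈ s, 1 ≤ i ∧ i ≤ n) (h : p ^ e ∣ s.lcm id) : p ^ e ≤ n := by
  induction s using Finset.induction_on with
  | empty =>
    simp only [Finset.lcm_empty, Nat.dvd_one] at h
    omega
  | insert a s ha ih =>
    rw [Finset.lcm_insert] at h
    have h' : p ^ e ∣ a ∨ p ^ e ∣ s.lcm id := by
      have hs0 : s.lcm id ≠ 0 := by
        rw [Ne, Finset.lcm_eq_zero_iff]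
        simp only [id, not_exists, not_and]
        intro i hi h0
        have := hs i (mem_insert_of_mem hi)
        omega
      have ha0 : a ≠ 0 := by
        have := hs a (mem_insert_self _ _)
        omega
      have h2 : p ^ e ∣ Nat.lcm a (s.lcm id) := h
      rw [hp.pow_dvd_iff_le_factorization (Nat.lcm_ne_zero ha0 hs0),
        Nat.factorization_lcm ha0 hs0, Finsupp.sup_apply, le_sup_iff] at h2
      rwa [hp.pow_dvd_iff_le_factorization ha0, hp.pow_dvd_iff_le_factorization hs0]
    rcases h' with h' | h'
    · have := hs a (mem_insert_self _ _)
      exact (Nat.le_of_dvd this.1 h').trans this.2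
    · exact ih (fun i hi => hs i (mem_insert_of_mem hi)) h'

lemma prime_pow_le_of_dvd_Lab_one {r : ℕ → ℤ} {p e n : ℕ} (hp : p.Prime) (hn : 1 ≤ n)
    (h : p ^ e ∣ Lab r 1 n) : p ^ e ≤ n :=
  hp.pow_le_of_dvd_finset_lcm hn _ (fun i hi => by simpa using (mem_filter.1 hi).1) h

lemma partialSum_sub (r : ℕ → ℤ) {m n : ℕ} (h : m ≤ n) :
    partialSum r n - partialSum r m = ∑ i ∈ Ioc m n, (r i : ℚ) / i := by
  unfold partialSum
  have e : ∀ k, Icc 1 k = Ioc 0 k := fun k => by ext; simp [Nat.succ_le_iff]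
  rw [e, e, ← Finset.sum_Ioc_consecutive _ (Nat.zero_le m) h]
  ring

lemma windowNumerator_eq (r : ℕ → ℤ) {a b m n : ℕ} (ham : a ≤ m) (hmn : m ≤ n) (hnb : n ≤ b) :
    (windowNumerator r a b m n : ℚ) =
      (∏ j ∈ Ioc a b, (j : ℚ)) * (partialSum r n - partialSum r m) := by
  rw [partialSum_sub r hmn, Finset.mul_sum]
  unfold windowNumerator
  push_cast
  refine Finset.sum_congr rfl fun i hi => ?_
  rw [mem_Ioc] at hi
  have hi' : i ∈ Ioc a b := by rw [mem_Ioc]; omega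
  rw [← Finset.mul_prod_erase _ _ hi']
  have : (i : ℚ) ≠ 0 := by norm_cast; omega
  field_simp

lemma abs_windowNumerator_le (r : ℕ → ℤ) {a b m n R : ℕ} (hR : ∀ i, 1 ≤ i → |r i| ≤ R)
    (ham : a ≤ m) (hnb : n ≤ b) :
    |windowNumerator r a b m n| ≤ (b - a : ℕ) * (R * (b : ℤ) ^ (b - a)) := by
  unfold windowNumerator
  refine (Finset.abs_sum_le_sum_abs _ _).trans ?_
  have hterm : ∀ i ∈ Ioc m n, |r i * ∏ j ∈ (Ioc a b).erase i, (j : ℤ)| ≤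
      R * (b : ℤ) ^ (b - a) := by
    intro i hi
    rw [mem_Ioc] at hi
    rw [abs_mul]
    refine mul_le_mul (hR i (by omega)) ?_ (abs_nonneg _) (by positivity)
    rw [Finset.abs_prod]
    calc ∏ j ∈ (Ioc a b).erase i, |(j : ℤ)|
        ≤ ∏ j ∈ (Ioc a b).erase i, (b : ℤ) := by
          refine Finset.prod_le_prod (fun _ _ => abs_nonneg _) fun j hj => ?_
          have := mem_Ioc.1 (mem_of_mem_erase hj)
          simp only [Nat.abs_cast]
          exact_mod_cast this.2
      _ = (b : ℤ) ^ ((Ioc a b).erase i).card := by simp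
      _ ≤ (b : ℤ) ^ (b - a) := by
          refine pow_le_pow_right₀ (by norm_cast; omega) ?_
          exact (Finset.card_erase_le).trans (by simp)
  refine (Finset.sum_le_card_nsmul _ _ _ hterm).trans ?_
  rw [nsmul_eq_mul, Nat.card_Ioc]
  refine mul_le_mul_of_nonneg_right ?_ (by positivity)
  norm_cast
  omega

lemma windowNumerator_ne_zero (r : ℕ → ℤ) {a b m n R i : ℕ} (hR : ∀ i, 1 ≤ i → |r i| ≤ R)
    (ham : a ≤ m) (hnb : n ≤ b) (hi : i ∈ Ioc m n) (hri : r i ≠ 0)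
    (ha : R * (b - a) ^ (b - a) ≤ a) : windowNumerator r a b m n ≠ 0 := by
  intro h0
  have hi2 := mem_Ioc.1 hi
  have hdvd : (i : ℤ) ∣ r i * ∏ j ∈ (Ioc a b).erase i, (j : ℤ) := by
    unfold windowNumerator at h0
    rw [← Finset.add_sum_erase _ _ hi] at h0
    rw [eq_neg_of_add_eq_zero_left h0, dvd_neg]
    refine Finset.dvd_sum fun k hk => Dvd.dvd.mul_left (Finset.dvd_prod_of_mem _ ?_) _
    rw [mem_erase, mem_Ioc] at hk
    rw [mem_erase, mem_Ioc]
    omega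
  have hmod : (∏ j ∈ (Ioc a b).erase i, ((j : ℤ) - i)) ≡ ∏ j ∈ (Ioc a b).erase i, (j : ℤ)
      [ZMOD i] :=
    Int.ModEq.prod fun j _ => by
      simp [Int.modEq_iff_dvd]
  have hdvd' : (i : ℤ) ∣ r i * ∏ j ∈ (Ioc a b).erase i, ((j : ℤ) - i) :=
    (hmod.mul_left (r i)).dvd_iff.2 hdvd
  have hne : r i * ∏ j ∈ (Ioc a b).erase i, ((j : ℤ) - i) ≠ 0 := by
    refine mul_ne_zero hri (Finset.prod_ne_zero_iff.2 fun j hj => ?_)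
    have := ne_of_mem_erase hj
    omega
  have hle := Int.le_of_dvd (abs_pos.2 hne) ((dvd_abs _ _).2 hdvd')
  have hub : |r i * ∏ j ∈ (Ioc a b).erase i, ((j : ℤ) - i)| ≤ R * ((b - a : ℕ) : ℤ) ^ (b - a) := by
    rw [abs_mul]
    refine mul_le_mul (hR i (by omega)) ?_ (abs_nonneg _) (by positivity)
    rw [Finset.abs_prod]
    calc ∏ j ∈ (Ioc a b).erase i, |(j : ℤ) - i|
        ≤ ∏ j ∈ (Ioc a b).erase i, ((b - a : ℕ) : ℤ) := by
          refine Finset.prod_le_prod (fun _ _ => abs_nonneg _) fun j hj => ?_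
          have := mem_Ioc.1 (mem_of_mem_erase hj)
          rw [abs_le]
          omega
      _ = ((b - a : ℕ) : ℤ) ^ ((Ioc a b).erase i).card := by simp
      _ ≤ ((b - a : ℕ) : ℤ) ^ (b - a) := by
          refine pow_le_pow_right₀ (by norm_cast; omega) ?_
          exact (Finset.card_erase_le).trans (by simp)
  have : ((R * (b - a) ^ (b - a) : ℕ) : ℤ) ≤ a := by exact_mod_cast ha
  push_cast at this hub
  omega

lemma prime_pow_le_of_dvd_of_dvd {r : ℕ → ℤ} {p e a b m n : ℕ} (hp : p.Prime)
    (ham : a ≤ m) (hmn : m < n) (hnb : n ≤ b) (h0 : windowNumerator r a b m n ≠ 0)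
    (hm : ((p ^ e : ℕ) : ℤ) ∣ Xab r 1 m) (hn : ((p ^ e : ℕ) : ℤ) ∣ Xab r 1 n) :
    p ^ e ≤ n * (windowNumerator r a b m n).natAbs := by
  obtain ⟨c, hc⟩ := Lab_one_dvd_Lab_one r hmn.le
  have key : (Lab r 1 n : ℤ) * windowNumerator r a b m n =
      (∏ j ∈ Ioc a b, (j : ℤ)) * (Xab r 1 n - c * Xab r 1 m) := by
    rw [← Int.cast_inj (α := ℚ)]
    push_cast
    rw [windowNumerator_eq r ham hmn.le hnb, Xab_one_eq, Xab_one_eq, hc]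
    push_cast
    ring
  have hdvd : ((p ^ e : ℕ) : ℤ) ∣ (Lab r 1 n : ℤ) * windowNumerator r a b m n := by
    rw [key]
    exact Dvd.dvd.mul_left (dvd_sub hn (hm.mul_left _)) _
  rw [Int.natCast_dvd, Int.natAbs_mul, Int.natAbs_natCast] at hdvd
  obtain ⟨y, z, hy, hz, hyz⟩ := (Nat.dvd_mul).1 hdvd
  obtain ⟨k, -, rfl⟩ := (Nat.dvd_prime_pow hp).1 (Dvd.intro _ hyz)
  rw [← hyz]
  exact Nat.mul_le_mul (prime_pow_le_of_dvd_Lab_one hp (by omega) hy)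
    (Nat.le_of_dvd (Int.natAbs_pos.2 h0) hz)

lemma periodic_add_mul {r : ℕ → ℤ} {t : ℕ} (hper : ∀ i, 1 ≤ i → r (i + t) = r i)
    {i : ℕ} (hi : 1 ≤ i) (k : ℕ) : r (i + k * t) = r i := by
  induction k with
  | zero => simp
  | succ k ih => rw [Nat.succ_mul, ← add_assoc, hper _ (by omega), ih]

lemma exists_abs_le_of_periodic {r : ℕ → ℤ} {t : ℕ} (ht : 1 ≤ t)
    (hper : ∀ i, 1 ≤ i → r (i + t) = r i) : ∃ R : ℕ, 1 ≤ R ∧ ∀ i, 1 ≤ i → |r i| ≤ R := by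
  refine ⟨rstar r t + 1, by omega, fun i hi => ?_⟩
  have h : r i = r ((i - 1) % t + 1) := by
    rw [← periodic_add_mul hper (i := (i - 1) % t + 1) (by omega) ((i - 1) / t)]
    congr 1
    have := Nat.mod_add_div' (i - 1) t
    omega
  have hlt := Nat.mod_lt (i - 1) ht
  have hle : (r ((i - 1) % t + 1)).natAbs ≤ rstar r t :=
    Finset.le_sup (f := fun i => (r i).natAbs) (mem_Icc.2 ⟨by omega, by omega⟩)
  rw [h, Int.abs_eq_natAbs]
  omega

lemma exists_mem_Ioc_ne_zero {r : ℕ → ℤ} {t i₁ m n : ℕ} (ht : 1 ≤ t)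
    (hper : ∀ i, 1 ≤ i → r (i + t) = r i) (hi₁pos : 1 ≤ i₁) (hi₁ : r i₁ ≠ 0)
    (hm : i₁ ≤ m) (hmn : m + t ≤ n) : ∃ i ∈ Ioc m n, r i ≠ 0 := by
  refine ⟨i₁ + ((m - i₁) / t + 1) * t, ?_, by rwa [periodic_add_mul hper hi₁pos]⟩
  have h1 := Nat.mod_add_div' (m - i₁) t
  have h2 := Nat.mod_lt (m - i₁) ht
  rw [mem_Ioc, Nat.succ_mul]
  omega

/-- `L_n` grows faster than any polynomial. -/
lemma exists_pow_le_mul_Lab {r : ℕ → ℤ} {t i₁ : ℕ} (ht : 1 ≤ t)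
    (hper : ∀ i, 1 ≤ i → r (i + t) = r i) (hi₁pos : 1 ≤ i₁) (hi₁ : r i₁ ≠ 0) (A : ℕ) :
    ∃ C : ℕ, ∀ n, i₁ ≤ n → n ^ A ≤ C * Lab r 1 n := by
  have hinf : {q : ℕ | q.Prime ∧ q ≡ 1 [MOD t]}.Infinite :=
    Nat.infinite_setOfPred_prime_modEq_one (by omega)
  obtain ⟨s, hs, hcard⟩ := hinf.exists_subset_card_eq A
  refine ⟨∏ q ∈ s, (i₁ * q), fun n hn => ?_⟩
  have hprime : ∀ q ∈ s, q.Prime ∧ q ≡ 1 [MOD t] := fun q hq => hs hq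
  have hdvd : ∀ q ∈ s, q ^ Nat.log q (n / i₁) ∣ Lab r 1 n := by
    intro q hq
    obtain ⟨hp, hmod⟩ := hprime q hq
    have hpos : n / i₁ ≠ 0 := (Nat.div_pos hn hi₁pos).ne'
    have hle : i₁ * q ^ Nat.log q (n / i₁) ≤ n :=
      (Nat.mul_le_mul_left _ (Nat.pow_log_le_self q hpos)).trans (Nat.mul_div_le _ _)
    have hq1 : 1 ≤ q ^ Nat.log q (n / i₁) := Nat.one_le_pow _ _ hp.pos
    refine (Dvd.intro_left i₁ rfl).trans (dvd_Lab_one (Nat.mul_pos hi₁pos hq1) hle ?_)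
    have hm1 : t ∣ q ^ Nat.log q (n / i₁) - 1 :=
      (Nat.modEq_iff_dvd' hq1).1 (by simpa using (hmod.pow (Nat.log q (n / i₁))).symm)
    obtain ⟨k, hk⟩ := hm1
    have : i₁ * q ^ Nat.log q (n / i₁) = i₁ + (i₁ * k) * t := by
      rw [show q ^ Nat.log q (n / i₁) = 1 + t * k by omega]
      ring
    rwa [this, periodic_add_mul hper hi₁pos]
  have hprod : ∏ q ∈ s, q ^ Nat.log q (n / i₁) ∣ Lab r 1 n := by
    refine Finset.prod_dvd_of_isRelPrime (fun q hq q' hq' hne => ?_) hdvd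
    exact (Nat.coprime_iff_isRelPrime.1 (Nat.Coprime.pow _ _
      ((Nat.coprime_primes (hprime q hq).1 (hprime q' hq').1).2 hne)))
  calc n ^ A = ∏ q ∈ s, n := by simp [hcard]
    _ ≤ ∏ q ∈ s, (i₁ * q) * q ^ Nat.log q (n / i₁) := by
      refine Finset.prod_le_prod' fun q hq => ?_
      have h1 := Nat.lt_pow_succ_log_self (hprime q hq).1.one_lt (n / i₁)
      have h2 := (Nat.div_lt_iff_lt_mul hi₁pos).1 h1
      rw [pow_succ] at h2
      nlinarith
    _ = (∏ q ∈ s, (i₁ * q)) * ∏ q ∈ s, q ^ Nat.log q (n / i₁) := Finset.prod_mul_distrib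
    _ ≤ _ := Nat.mul_le_mul_left _
      (Nat.le_of_dvd (Nat.pos_of_ne_zero (Lab_one_ne_zero r n)) hprod)

lemma le_pow_of_forall_prime_pow_le {x M B : ℕ} (hx : x ≠ 0) (hB : 1 ≤ B)
    (hM : ∀ p, p.Prime → p ∣ x → p < M)
    (h : ∀ p, p.Prime → p < M → p ^ x.factorization p ≤ B) : x ≤ B ^ M := by
  have hsub : x.primeFactors ⊆ range M := fun p hp =>
    mem_range.2 (hM p (Nat.prime_of_mem_primeFactors hp) (Nat.dvd_of_mem_primeFactors hp))
  calc x = ∏ p ∈ x.primeFactors, p ^ x.factorization p :=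
        (Nat.prod_factorization_pow_eq_self hx).symm
    _ ≤ ∏ p ∈ x.primeFactors, B := Finset.prod_le_prod' fun p hp =>
        h p (Nat.prime_of_mem_primeFactors hp) (mem_range.1 (hsub hp))
    _ = B ^ x.primeFactors.card := by simp
    _ ≤ B ^ M := Nat.pow_le_pow_right hB (by simpa using Finset.card_le_card hsub)

/-- If every obstruction in a set of size `M` rules out at most one of `M + 1` indices, then some
index is not ruled out. -/
lemma exists_forall_not_of_unique {M : ℕ} (bad : ℕ → ℕ → Prop)
    (h : ∀ p < M, ∀ j k, j < k → k ≤ M → bad p j → bad p k → False) :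
    ∃ j ≤ M, ∀ p < M, ¬ bad p j := by
  by_contra! hcon
  choose! f hf using hcon
  obtain ⟨j, hj, k, hk, hjk, hfe⟩ := Finset.exists_ne_map_eq_of_card_lt_of_maps_to
    (s := range (M + 1)) (t := range M) (by simp)
    (f := f) (fun j hj => mem_coe.2 <| mem_range.2 (hf j (Nat.lt_succ_iff.1 (mem_range.1 hj))).1)
  have hj' := Nat.lt_succ_iff.1 (mem_range.1 hj)
  have hk' := Nat.lt_succ_iff.1 (mem_range.1 hk)
  rcases lt_or_gt_of_ne hjk with hlt | hlt
  · exact h _ (hf j hj').1 j k hlt hk' (hf j hj').2 (hfe ▸ (hf k hk').2)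
  · exact h _ (hf k hk').1 k j hlt hj' (hf k hk').2 (hfe ▸ (hf j hj').2)

/-- If all `X_n` with `n` in a long window have only prime factors below `M`, then some `L_n` in
that window is bounded by a power of the right end point. -/
lemma exists_Lab_le {r : ℕ → ℤ} {t i₁ M R a : ℕ} (ht : 1 ≤ t)
    (hper : ∀ i, 1 ≤ i → r (i + t) = r i) (hi₁pos : 1 ≤ i₁) (hi₁ : r i₁ ≠ 0)
    (hM : 1 ≤ M) (hR1 : 1 ≤ R) (hR : ∀ i, 1 ≤ i → |r i| ≤ R) (hia : i₁ ≤ a)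
    (ha : R * (M * t) ^ (M * t) ≤ a)
    (hX : ∀ n, i₁ ≤ n → ∀ p : ℕ, p.Prime → (p : ℤ) ∣ Xab r 1 n → p < M) :
    ∃ n, a ≤ n ∧ n ≤ a + M * t ∧ Lab r 1 n ≤ 2 * (a + M * t) ^ (M * t) *
      ((a + M * t) * (M * t * (R * (a + M * t) ^ (M * t)))) ^ M := by
  set W := M * t with hW
  set b := a + W with hb
  set B := b * (W * (R * b ^ W)) with hB
  have hba : b - a = W := by omega
  have hWpos : 1 ≤ W := Nat.mul_pos hM ht
  have hbpos : 1 ≤ b := by omega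
  have hBpos : 1 ≤ B :=
    Nat.mul_pos hbpos (Nat.mul_pos hWpos (Nat.mul_pos hR1 (Nat.pow_pos hbpos)))
  have hjW : ∀ j ≤ M, j * t ≤ W := fun j hj => Nat.mul_le_mul_right t hj
  have hstep : ∀ j k, j < k → a + j * t + t ≤ a + k * t := fun j k hjk => by nlinarith
  have hne : ∀ j k, j < k → k ≤ M → windowNumerator r a b (a + j * t) (a + k * t) ≠ 0 := by
    intro j k hjk hk
    obtain ⟨i, hi, hri⟩ := exists_mem_Ioc_ne_zero (m := a + j * t) ht hper hi₁pos hi₁ (by omega)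
      (hstep j k hjk)
    exact windowNumerator_ne_zero r hR (by omega) (by have := hjW k hk; omega) hi hri
      (by rwa [hba])
  have hP : (0 : ℚ) < ∏ j ∈ Ioc a b, (j : ℚ) := Finset.prod_pos fun j hj => by
    have := mem_Ioc.1 hj
    norm_cast
    omega
  obtain ⟨j, hj, hgood⟩ := exists_forall_not_of_unique (M := M)
    (fun p j => (p = 0 ∧ 2 * (∏ i ∈ Ioc a b, (i : ℚ)) * |partialSum r (a + j * t)| < 1) ∨
      (p.Prime ∧ B < p ^ (Xab r 1 (a + j * t)).natAbs.factorization p)) (by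
    rintro p - j k hjk hk hbj hbk
    have hkW := hjW k hk
    have hs := hstep j k hjk
    rcases hbj with ⟨rfl, hbj⟩ | ⟨hp, hbj⟩
    · rcases hbk with ⟨-, hbk⟩ | ⟨hp, -⟩
      · have h1 : (1 : ℚ) ≤ |(windowNumerator r a b (a + j * t) (a + k * t) : ℚ)| := by
          exact_mod_cast Int.one_le_abs (hne j k hjk hk)
        rw [windowNumerator_eq r (by omega) (by omega) (by omega), abs_mul, abs_of_pos hP] at h1
        have h2 := abs_sub (partialSum r (a + k * t)) (partialSum r (a + j * t))
        have h3 := mul_le_mul_of_nonneg_left h2 hP.le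
        nlinarith
      · exact Nat.not_prime_zero hp
    · rcases hbk with ⟨rfl, -⟩ | ⟨-, hbk⟩
      · exact Nat.not_prime_zero hp
      · set x := (Xab r 1 (a + j * t)).natAbs
        set y := (Xab r 1 (a + k * t)).natAbs
        set e := min (x.factorization p) (y.factorization p)
        have hlt : B < p ^ e := by
          rcases min_choice (x.factorization p) (y.factorization p) with h | h <;>
            simpa only [e, h]
        have hle := prime_pow_le_of_dvd_of_dvd (r := r) (a := a) (b := b) (e := e) hp
          (m := a + j * t) (n := a + k * t) (by omega) (by omega) (by omega) (hne j k hjk hk)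
          (Int.natCast_dvd.2 ((Nat.pow_dvd_pow p (min_le_left _ _)).trans
            (Nat.ordProj_dvd x p)))
          (Int.natCast_dvd.2 ((Nat.pow_dvd_pow p (min_le_right _ _)).trans
            (Nat.ordProj_dvd y p)))
        have hD := abs_windowNumerator_le r (a := a) (b := b) (m := a + j * t) (n := a + k * t)
          hR (by omega) (by omega)
        rw [hba, Int.abs_eq_natAbs] at hD
        have hD' : (windowNumerator r a b (a + j * t) (a + k * t)).natAbs ≤ W * (R * b ^ W) := by
          exact_mod_cast hD
        have : p ^ e ≤ B := hle.trans (Nat.mul_le_mul (by omega) hD')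
        omega)
  have hjt := hjW j hj
  refine ⟨a + j * t, by omega, by omega, ?_⟩
  set n := a + j * t with hn
  have hin : i₁ ≤ n := by omega
  have hX0 : Xab r 1 n ≠ 0 := by
    intro h0
    obtain ⟨p, hMp, hp⟩ := Nat.exists_infinite_primes M
    have := hX n hin p hp (by simp [h0])
    omega
  have hXle : (Xab r 1 n).natAbs ≤ B ^ M :=
    le_pow_of_forall_prime_pow_le (Int.natAbs_ne_zero.2 hX0) hBpos
      (fun p hp hpx => hX n hin p hp (Int.natCast_dvd.2 hpx))
      (fun p hp hpM => not_lt.1 fun hlt => hgood p hpM (Or.inr ⟨hp, hlt⟩))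
  have harch : 1 ≤ 2 * (∏ i ∈ Ioc a b, (i : ℚ)) * |partialSum r n| :=
    not_lt.1 fun hlt => hgood 0 (by omega) (Or.inl ⟨rfl, hlt⟩)
  have hPle : ∏ i ∈ Ioc a b, (i : ℚ) ≤ (b : ℚ) ^ W := by
    calc ∏ i ∈ Ioc a b, (i : ℚ) ≤ ∏ i ∈ Ioc a b, (b : ℚ) :=
          Finset.prod_le_prod (fun _ _ => by positivity) fun i hi => by
            exact_mod_cast (mem_Ioc.1 hi).2
      _ = (b : ℚ) ^ W := by simp [hba]
  have habs : |(Xab r 1 n : ℚ)| = Lab r 1 n * |partialSum r n| := by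
    rw [Xab_one_eq, abs_mul, Nat.abs_cast]
  have hXq : |(Xab r 1 n : ℚ)| ≤ (B : ℚ) ^ M := by
    have : |Xab r 1 n| ≤ (B : ℤ) ^ M := by
      rw [Int.abs_eq_natAbs]
      exact_mod_cast hXle
    exact_mod_cast this
  have : (Lab r 1 n : ℚ) ≤ 2 * (b : ℚ) ^ W * (B : ℚ) ^ M := by
    calc (Lab r 1 n : ℚ) ≤ Lab r 1 n * (2 * (∏ i ∈ Ioc a b, (i : ℚ)) * |partialSum r n|) :=
          le_mul_of_one_le_right (by positivity) harch
      _ = 2 * (∏ i ∈ Ioc a b, (i : ℚ)) * |(Xab r 1 n : ℚ)| := by rw [habs]; ring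
      _ ≤ 2 * (b : ℚ) ^ W * (B : ℚ) ^ M := by gcongr
  exact_mod_cast this

lemma exists_prime_ge_dvd_Xab {r : ℕ → ℤ} {t i₁ : ℕ} (ht : 1 ≤ t)
    (hper : ∀ i, 1 ≤ i → r (i + t) = r i) (hi₁pos : 1 ≤ i₁) (hi₁ : r i₁ ≠ 0)
    {M : ℕ} (hM : 1 ≤ M) :
    ∃ n : ℕ, i₁ ≤ n ∧ ∃ p : ℕ, p.Prime ∧ M ≤ p ∧ (p : ℤ) ∣ Xab r 1 n := by
  by_contra! hcon
  have hX : ∀ n, i₁ ≤ n → ∀ p : ℕ, p.Prime → (p : ℤ) ∣ Xab r 1 n → p < M :=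
    fun n hn p hp hd => not_le.1 fun hle => hcon n hn p hp hle hd
  obtain ⟨R, hR1, hR⟩ := exists_abs_le_of_periodic ht hper
  set W := M * t with hW
  set E := W + (W + 1) * M with hE
  obtain ⟨C, hC⟩ := exists_pow_le_mul_Lab ht hper hi₁pos hi₁ (E + 1)
  set c := 2 * (W * R) ^ M with hc
  set a := i₁ + R * W ^ W + W + C * (c * 2 ^ E) with ha
  obtain ⟨n, han, hnb, hL⟩ := exists_Lab_le (a := a) ht hper hi₁pos hi₁ hM hR1 hR (by omega)
    (by rw [← hW]; omega) hX
  rw [← hW] at hL hnb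
  have hb : a + W ≤ 2 * n := by omega
  have hL' : Lab r 1 n ≤ c * 2 ^ E * n ^ E := by
    calc Lab r 1 n ≤ _ := hL
      _ = c * (a + W) ^ E := by
        rw [hc, hE]
        generalize a + W = b
        ring
      _ ≤ c * (2 * n) ^ E := by gcongr
      _ = c * 2 ^ E * n ^ E := by ring
  have hnpos : 0 < n := by omega
  have h1 : n * n ^ E ≤ C * (c * 2 ^ E) * n ^ E := by
    calc n * n ^ E = n ^ (E + 1) := by ring
      _ ≤ C * Lab r 1 n := hC n (by omega)
      _ ≤ C * (c * 2 ^ E * n ^ E) := Nat.mul_le_mul_left _ hL'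
      _ = _ := by ring
  have h2 : n ≤ C * (c * 2 ^ E) := Nat.le_of_mul_le_mul_right h1 (by positivity)
  omega

/-- For every `M > max(r*, t)` there exist `n ≥ i₁` and a prime `p ≥ M` dividing `X_n`.
In particular, the set of primes dividing some `X_n` is unbounded. -/
theorem exists_large_prime_divisor_of_Xn
    (t : ℕ) (r : ℕ → ℤ) (ht : 1 ≤ t)
    (hper : ∀ i, 1 ≤ i → r (i + t) = r i)
    (hnz : ∃ i, 1 ≤ i ∧ r i ≠ 0)
    (i₁ : ℕ) (hi₁pos : 1 ≤ i₁) (hi₁ : r i₁ ≠ 0)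
    (hi₁min : ∀ j, 1 ≤ j → j < i₁ → r j = 0) :
    (∀ M : ℕ, max (rstar r t) t < M →
      ∃ n : ℕ, i₁ ≤ n ∧ ∃ p : ℕ, p.Prime ∧ M ≤ p ∧ (p : ℤ) ∣ Xab r 1 n) ∧
    ∀ B : ℕ, ∃ p : ℕ, p.Prime ∧ B ≤ p ∧ ∃ n : ℕ, (p : ℤ) ∣ Xab r 1 n := by
  refine ⟨fun M hM => exists_prime_ge_dvd_Xab ht hper hi₁pos hi₁ (by omega), fun B => ?_⟩
  obtain ⟨n, -, p, hp, hBp, hd⟩ :=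
    exists_prime_ge_dvd_Xab ht hper hi₁pos hi₁ (M := B + 1) (by omega)
  exact ⟨p, hp, by omega, n, hd⟩
end

section
/- Suppose that r_i ≠ 0 for every i with gcd(i, t) = 1. Set m = 1 + max(r*, t) and c = exp(exp(m·(3 + 6/log m))). Then for every positive integer a there exists an integer b with a < b < c·a such that v_{a,b} < v_{a,b-1}. -/
open Finset

def gab (r : ℕ → ℤ) (a b : ℕ) : ℕ :=
  Int.gcd (Xab r a b) (Lab r a b)

/-- `vab r a b` is the denominator of `Σ_{i=a}^b r_i / i` in lowest terms. -/
def vab (r : ℕ → ℤ) (a b : ℕ) : ℕ :=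
  Lab r a b / gab r a b

/-- The weighted harmonic sum `Σ_{i=a}^b r_i / i`. -/
def harmonicSum (r : ℕ → ℤ) (a b : ℕ) : ℚ :=
  ∑ i ∈ Finset.Icc a b, (r i : ℚ) / i

lemma Lab_ne_zero (r : ℕ → ℤ) {a : ℕ} (b : ℕ) (ha : 1 ≤ a) : Lab r a b ≠ 0 := by
  unfold Lab
  rw [Ne, Finset.lcm_eq_zero_iff]
  rintro ⟨i, hi, h0⟩
  have := (Finset.mem_Icc.mp (Finset.mem_filter.mp hi).1).1
  simp only [id] at h0
  omega

lemma Xab_eq_mul_harmonicSum (r : ℕ → ℤ) {a : ℕ} (b : ℕ) (ha : 1 ≤ a) :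
    (Xab r a b : ℚ) = Lab r a b * harmonicSum r a b := by
  unfold Xab harmonicSum
  push_cast
  rw [Finset.mul_sum]
  refine Finset.sum_congr rfl fun i hi => ?_
  rcases eq_or_ne (r i) 0 with h | h
  · simp [h]
  · have hdvd : i ∣ Lab r a b :=
      Finset.dvd_lcm (f := id) (Finset.mem_filter.mpr ⟨hi, h⟩)
    have hi0 : (i : ℚ) ≠ 0 := by
      have := (Finset.mem_Icc.mp hi).1
      exact_mod_cast (by omega : i ≠ 0)
    rw [Int.cast_div (by exact_mod_cast hdvd) (by exact_mod_cast hi0)]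
    push_cast
    ring

lemma vab_eq_den (r : ℕ → ℤ) {a : ℕ} (b : ℕ) (ha : 1 ≤ a) :
    vab r a b = (harmonicSum r a b).den := by
  have hL := Lab_ne_zero r b ha
  have hL' : (Lab r a b : ℚ) ≠ 0 := by exact_mod_cast hL
  have hS : harmonicSum r a b = (Xab r a b : ℚ) / ((Lab r a b : ℤ) : ℚ) := by
    rw [Xab_eq_mul_harmonicSum r b ha]
    push_cast
    field_simp
  rw [hS, ← Rat.divInt_eq_div, Rat.den_divInt]
  simp only [vab, gab, Int.natCast_eq_zero, hL, if_false, Int.natAbs_natCast,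
    Int.gcd_comm (Xab r a b)]

lemma padicNorm_intCast_div_lt {q : ℕ} [Fact q.Prime] (z : ℤ) {i f : ℕ}
    (h : ¬ q ^ f ∣ i) : padicNorm q ((z : ℚ) / i) < (q : ℚ) ^ f := by
  have hq : (0 : ℚ) < q := by exact_mod_cast (Fact.out : q.Prime).pos
  have h1 : ¬ (((q ^ f : ℕ) : ℤ) ∣ (i : ℤ)) := by exact_mod_cast h
  rw [padicNorm.dvd_iff_norm_le, not_le, zpow_neg, zpow_natCast] at h1
  have h2 := padicNorm.of_int (p := q) z
  have h3 : padicNorm q ((i : ℤ) : ℚ) ≤ 1 := padicNorm.of_int _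
  push_cast at h1 h3
  have hpos : (0 : ℚ) < (q : ℚ) ^ f := by positivity
  have hipos : 0 < padicNorm q (i : ℚ) := lt_trans (by positivity) h1
  rw [padicNorm.div, div_lt_iff₀ hipos]
  calc padicNorm q z ≤ 1 := h2
    _ = (q : ℚ) ^ f * ((q : ℚ) ^ f)⁻¹ := by field_simp
    _ < _ := by gcongr

lemma padicNorm_natCast_prime_pow (q : ℕ) [Fact q.Prime] (f : ℕ) :
    padicNorm q ((q : ℚ) ^ f) = ((q : ℚ) ^ f)⁻¹ := by
  induction f with
  | zero => simp
  | succ n ih => rw [pow_succ, padicNorm.mul, ih, padicNorm.padicNorm_p_of_prime, mul_inv]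

lemma padicNorm_mul_prime_pow_lt_one_iff {q : ℕ} [Fact q.Prime] (x : ℚ) (f : ℕ) :
    padicNorm q ((q : ℚ) ^ f * x) < 1 ↔ padicNorm q x < (q : ℚ) ^ f := by
  have hq : (0 : ℚ) < q := by exact_mod_cast (Fact.out : q.Prime).pos
  rw [padicNorm.mul, padicNorm_natCast_prime_pow, inv_mul_lt_iff₀ (by positivity), mul_one]

lemma prime_pow_dvd_den_iff {q : ℕ} [Fact q.Prime] (x : ℚ) {k : ℕ} (hk : 1 ≤ k) :
    q ^ k ∣ x.den ↔ (q : ℚ) ^ k ≤ padicNorm q x := by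
  have hqp : q.Prime := Fact.out
  have hq : (0 : ℚ) < q := by exact_mod_cast hqp.pos
  have hq1 : (1 : ℚ) < (q : ℚ) ^ k := one_lt_pow₀ (by exact_mod_cast hqp.one_lt) (by omega)
  have hden0 : 0 < padicNorm q (x.den : ℚ) :=
    lt_of_le_of_ne (padicNorm.nonneg _)
      (Ne.symm (padicNorm.nonzero (by exact_mod_cast x.den_nz)))
  have hx : padicNorm q x = padicNorm q x.num / padicNorm q (x.den : ℚ) := by
    rw [← padicNorm.div, Rat.num_div_den]
  have hdvd : q ^ k ∣ x.den ↔ padicNorm q (x.den : ℚ) ≤ ((q : ℚ) ^ k)⁻¹ := by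
    have := padicNorm.dvd_iff_norm_le (p := q) (n := k) (z := (x.den : ℤ))
    rw [zpow_neg, zpow_natCast] at this
    rw [← Int.natCast_dvd_natCast, this]
    simp
  constructor
  · intro h
    have hnum : padicNorm q x.num = 1 := by
      rw [padicNorm.int_eq_one_iff]
      intro h2
      have h3 : q ∣ x.num.natAbs := Int.natCast_dvd.mp h2
      have h4 : q ∣ x.den := (dvd_pow_self q (by omega)).trans h
      have := Nat.dvd_gcd h3 h4
      rw [x.reduced] at this
      exact hqp.one_lt.ne' (Nat.dvd_one.mp this)
    rw [hx, hnum, le_div_iff₀ hden0]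
    have := hdvd.mp h
    calc (q : ℚ) ^ k * padicNorm q (x.den : ℚ) ≤ (q : ℚ) ^ k * ((q : ℚ) ^ k)⁻¹ := by gcongr
      _ = 1 := by field_simp
  · intro h
    rw [hdvd]
    rw [hx, le_div_iff₀ hden0] at h
    have h2 := padicNorm.of_int (p := q) x.num
    rw [← one_div, le_div_iff₀' (by positivity)]
    exact h.trans h2

lemma Rat.den_lt_den_of_padicNorm_lt {q : ℕ} [Fact q.Prime] {x y : ℚ} {k d : ℕ} {s : ℤ}
    (hk : 1 ≤ k) (hd : 0 < d) (hdq : d < q)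
    (hxy : x = y + (s : ℚ) / ((d * q ^ k : ℕ) : ℚ))
    (hx : padicNorm q x < (q : ℚ) ^ k) (hy : (q : ℚ) ^ k ≤ padicNorm q y) :
    x.den < y.den := by
  have hqp : q.Prime := Fact.out
  have hx' : ¬ q ^ k ∣ x.den := fun h => absurd ((prime_pow_dvd_den_iff x hk).mp h) (not_le.mpr hx)
  obtain ⟨w, hw⟩ := (prime_pow_dvd_den_iff y hk).mpr hy
  have hw0 : 0 < w := Nat.pos_of_ne_zero fun h => y.den_nz (by rw [hw, h, mul_zero])
  have hdvd : x.den ∣ y.den * d := by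
    have hq0 : (q : ℚ) ≠ 0 := by exact_mod_cast hqp.ne_zero
    have hd0 : (d : ℚ) ≠ 0 := by exact_mod_cast hd.ne'
    have hx_int : x = ((y.num * d + w * s : ℤ) : ℚ) / ((y.den * d : ℤ) : ℚ) := by
      rw [hxy]
      conv_lhs => rw [← Rat.num_div_den y]
      have hw' : (w : ℚ) ≠ 0 := by exact_mod_cast hw0.ne'
      push_cast [hw]
      field_simp
    have h2 := Rat.den_dvd (y.num * d + w * s) (y.den * d)
    rw [Rat.divInt_eq_div, ← hx_int] at h2
    exact_mod_cast h2
  obtain ⟨e, v, hv, hxv⟩ := Nat.exists_eq_pow_mul_and_not_dvd x.den_nz q hqp.ne_one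
  have hek : e < k := by
    by_contra hcon
    exact hx' (hxv ▸ (pow_dvd_pow q (not_lt.mp hcon)).mul_right v)
  have hvdvd : v ∣ w * d := by
    have h1 : v ∣ q ^ k * (w * d) := by
      refine (Dvd.intro_left (q ^ e) hxv.symm).trans ?_
      rw [hw, mul_assoc] at hdvd
      exact hdvd
    have hcop := (Nat.Coprime.pow_right k ((Nat.Prime.coprime_iff_not_dvd hqp).mpr hv).symm)
    exact hcop.dvd_of_dvd_mul_left h1
  have hvle : v ≤ w * d := Nat.le_of_dvd (by positivity) hvdvd
  calc x.den = q ^ e * v := hxv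
    _ ≤ q ^ (k - 1) * (w * d) := by
      gcongr
      · exact hqp.pos
      · omega
    _ < q ^ (k - 1) * (w * q) := by
      have := hqp.pos
      gcongr
    _ = y.den := by
      rw [hw]
      obtain ⟨j, rfl⟩ : ∃ j, k = j + 1 := ⟨k - 1, by omega⟩
      simp [pow_succ]
      ring

/-- If `a ≤ q ^ f`, the multiples of `q ^ f` in `[a, n]` are `q ^ f, 2 q ^ f, …`, and the
remaining terms of the weighted harmonic sum have smaller `q`-adic norm. -/
lemma padicNorm_harmonicSum_lt_iff {q : ℕ} [Fact q.Prime] (r : ℕ → ℤ) {a n f : ℕ} (ha : 1 ≤ a)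
    (haf : a ≤ q ^ f) :
    padicNorm q (harmonicSum r a n) < (q : ℚ) ^ f ↔
      padicNorm q (harmonicSum (fun j => r (j * q ^ f)) 1 (n / q ^ f)) < 1 := by
  have hqp : q.Prime := Fact.out
  have hq : (0 : ℚ) < q := by exact_mod_cast hqp.pos
  have hqf : 0 < q ^ f := pow_pos hqp.pos f
  set T := harmonicSum (fun j => r (j * q ^ f)) 1 (n / q ^ f) with hT
  set R := ∑ i ∈ (Finset.Icc a n).filter (fun i => ¬ q ^ f ∣ i), (r i : ℚ) / i with hR
  have hRlt : padicNorm q R < (q : ℚ) ^ f := by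
    refine padicNorm.sum_lt' (fun i hi => ?_) (by positivity)
    exact padicNorm_intCast_div_lt _ (Finset.mem_filter.mp hi).2
  have hmul : (q : ℚ) ^ f * (harmonicSum r a n - R) = T := by
    have h1 : harmonicSum r a n - R
        = ∑ i ∈ (Finset.Icc a n).filter (fun i => q ^ f ∣ i), (r i : ℚ) / i := by
      rw [sub_eq_iff_eq_add, hR]
      exact (Finset.sum_filter_add_sum_filter_not _ _ _).symm
    rw [h1, hT, harmonicSum, Finset.mul_sum]
    symm
    refine Finset.sum_bij (fun j _ => j * q ^ f) ?_ ?_ ?_ ?_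
    · intro j hj
      rw [Finset.mem_Icc] at hj
      rw [Finset.mem_filter, Finset.mem_Icc]
      refine ⟨⟨haf.trans (Nat.le_mul_of_pos_left _ (by omega)), ?_⟩, Dvd.intro_left _ rfl⟩
      exact (Nat.le_div_iff_mul_le hqf).mp hj.2
    · intro i _ j _ h
      exact Nat.eq_of_mul_eq_mul_right hqf h
    · intro i hi
      rw [Finset.mem_filter, Finset.mem_Icc] at hi
      obtain ⟨⟨h1, h2⟩, j, rfl⟩ := hi
      refine ⟨j, ?_, mul_comm _ _⟩
      rw [Finset.mem_Icc, Nat.le_div_iff_mul_le hqf, mul_comm]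
      refine ⟨Nat.pos_of_ne_zero ?_, h2⟩
      rintro rfl
      omega
    · intro j hj
      have : (j : ℚ) ≠ 0 := by
        have := (Finset.mem_Icc.mp hj).1
        exact_mod_cast (by omega : j ≠ 0)
      push_cast
      field_simp
  rw [← hmul, padicNorm_mul_prime_pow_lt_one_iff]
  constructor
  · intro h
    exact lt_of_le_of_lt padicNorm.sub (max_lt h hRlt)
  · intro h
    have : harmonicSum r a n = (harmonicSum r a n - R) + R := by ring
    rw [this]
    exact lt_of_le_of_lt padicNorm.nonarchimedean (max_lt h hRlt)

lemma periodic_eq_of_modEq {r : ℕ → ℤ} {t : ℕ} (hper : ∀ i, 1 ≤ i → r (i + t) = r i) {i j : ℕ}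
    (hi : 1 ≤ i) (hj : 1 ≤ j) (h : i ≡ j [MOD t]) : r i = r j := by
  have hadd : ∀ (k i : ℕ), 1 ≤ i → r (i + t * k) = r i := by
    intro k
    induction k with
    | zero => simp
    | succ n ih =>
      intro i hi
      rw [mul_add, mul_one, ← add_assoc, hper _ (by omega), ih i hi]
  wlog hij : i ≤ j generalizing i j
  · exact (this hj hi h.symm (by omega)).symm
  obtain ⟨k, hk⟩ := (Nat.modEq_iff_dvd' hij).mp h
  have : j = i + t * k := by omega
  rw [this, hadd k i hi]

lemma abs_le_rstar {r : ℕ → ℤ} {t : ℕ} (ht : 1 ≤ t) (hper : ∀ i, 1 ≤ i → r (i + t) = r i) {i : ℕ}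
    (hi : 1 ≤ i) : |r i| ≤ rstar r t := by
  obtain ⟨j, hj1, hj2, hj⟩ : ∃ j, 1 ≤ j ∧ j ≤ t ∧ j ≡ i [MOD t] := by
    rcases Nat.eq_zero_or_pos (i % t) with h | h
    · exact ⟨t, ht, le_rfl, by simp [Nat.ModEq, h]⟩
    · exact ⟨i % t, h, (Nat.mod_lt _ ht).le, Nat.mod_modEq _ _⟩
  rw [← periodic_eq_of_modEq hper hj1 hi hj, Int.abs_eq_natAbs]
  exact_mod_cast Finset.le_sup (f := fun i => (r i).natAbs) (Finset.mem_Icc.mpr ⟨hj1, hj2⟩)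

/-- Trailing zero weights can be dropped from a weighted harmonic sum. -/
lemma exists_last_ne_zero (r : ℕ → ℤ) {n : ℕ} (hn : 1 ≤ n) (h1 : r 1 ≠ 0) :
    ∃ d, 1 ≤ d ∧ d ≤ n ∧ r d ≠ 0 ∧ harmonicSum r 1 d = harmonicSum r 1 n := by
  induction n, hn using Nat.le_induction with
  | base => exact ⟨1, le_rfl, le_rfl, h1, rfl⟩
  | succ n hn ih =>
    by_cases h : r (n + 1) = 0
    · obtain ⟨d, hd1, hdn, hd, he⟩ := ih
      refine ⟨d, hd1, by omega, hd, ?_⟩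
      rw [he, harmonicSum, harmonicSum, Finset.sum_Icc_succ_top (by omega), h]
      simp
    · exact ⟨n + 1, by omega, le_rfl, h, rfl⟩

/-- A large prime `q` at which some initial sum has an unexpectedly small norm yields, for every
starting point `a`, a nearby drop of the denominator. -/
lemma exists_vab_lt_of_padicNorm_lt {r : ℕ → ℤ} {t m q n : ℕ} [Fact q.Prime] (ht : 1 ≤ t)
    (hper : ∀ i, 1 ≤ i → r (i + t) = r i) (hcop : ∀ i, 1 ≤ i → Nat.Coprime i t → r i ≠ 0)
    (hr : ∀ i, 1 ≤ i → |r i| < m) (htm : t < m) (hqm : m < q) (hn : 1 ≤ n)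
    (h : padicNorm q (harmonicSum r 1 n) < (q : ℚ) ^ Nat.log q n) {a : ℕ} (ha : 1 ≤ a) :
    ∃ b, a < b ∧ b < q ^ m * a ∧ vab r a b < vab r a (b - 1) := by
  have hqp : q.Prime := Fact.out
  set f := Nat.log q n with hf
  have hqf : 0 < q ^ f := pow_pos hqp.pos f
  have hqt : Nat.Coprime q t :=
    (Nat.Prime.coprime_iff_not_dvd hqp).mpr fun hd => by
      have := Nat.le_of_dvd ht hd
      omega
  have hφ : 0 < t.totient := Nat.totient_pos.mpr ht
  have hφt : t.totient ≤ t := Nat.totient_le t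
  rw [padicNorm_harmonicSum_lt_iff r le_rfl hqf] at h
  have hdn : 1 ≤ n / q ^ f :=
    (Nat.le_div_iff_mul_le hqf).mpr (by simpa using Nat.pow_log_le_self q (by omega))
  have hdlt : n / q ^ f < q := by
    rw [Nat.div_lt_iff_lt_mul hqf, mul_comm, ← pow_succ]
    exact Nat.lt_pow_succ_log_self hqp.one_lt n
  obtain ⟨d, hd1, hdle, hdne, hdeq⟩ :=
    exists_last_ne_zero (fun j => r (j * q ^ f)) hdn
      (by
        simp only [one_mul]
        exact hcop _ hqf (hqt.pow_left f))
  rw [← hdeq] at h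
  have hdq : d < q := by omega
  -- choose an exponent congruent to `f` modulo `φ(t)`
  obtain ⟨k, hk1, hk2, hkf⟩ : ∃ k, Nat.log q a + 1 ≤ k ∧ k ≤ Nat.log q a + t.totient ∧
      k ≡ f [MOD t.totient] := by
    set l := Nat.log q a + 1 with hl
    refine ⟨l + (f + (t.totient - l % t.totient)) % t.totient, by omega, ?_, ?_⟩
    · have := Nat.mod_lt (f + (t.totient - l % t.totient)) hφ
      omega
    · have h1 : l + (f + (t.totient - l % t.totient)) % t.totient
          ≡ l % t.totient + (f + (t.totient - l % t.totient)) [MOD t.totient] :=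
        (Nat.mod_modEq l _).symm.add (Nat.mod_modEq _ _)
      refine h1.trans ?_
      have h2 := Nat.mod_lt l hφ
      have h3 : l % t.totient + (f + (t.totient - l % t.totient)) = f + t.totient := by omega
      rw [h3]
      simp [Nat.ModEq]
  have hpow : q ^ k ≡ q ^ f [MOD t] := by
    have key : ∀ i j : ℕ, i ≤ j → i ≡ j [MOD t.totient] → q ^ i ≡ q ^ j [MOD t] := by
      intro i j hij hmod
      obtain ⟨c, hc⟩ := (Nat.modEq_iff_dvd' hij).mp hmod
      have hj : j = i + t.totient * c := by omega
      rw [hj, pow_add, pow_mul]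
      have := ((Nat.ModEq.pow_totient hqt).pow c).mul_left (q ^ i)
      simpa using this.symm
    rcases le_total k f with hle | hle
    · exact key _ _ hle hkf
    · exact (key _ _ hle hkf.symm).symm
  have hqk : 0 < q ^ k := pow_pos hqp.pos k
  have hrk : ∀ j, 1 ≤ j → r (j * q ^ k) = r (j * q ^ f) := fun j hj =>
    periodic_eq_of_modEq hper (Nat.mul_pos hj hqk) (Nat.mul_pos hj hqf) (hpow.mul_left j)
  have hak : a < q ^ k :=
    (Nat.lt_pow_succ_log_self hqp.one_lt a).trans_le (Nat.pow_le_pow_right hqp.pos hk1)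
  have hka : q ^ k ≤ q ^ t.totient * a := by
    calc q ^ k ≤ q ^ (t.totient + Nat.log q a) := Nat.pow_le_pow_right hqp.pos (by omega)
      _ = q ^ t.totient * q ^ Nat.log q a := pow_add _ _ _
      _ ≤ _ := Nat.mul_le_mul_left _ (Nat.pow_log_le_self q (by omega))
  set b := d * q ^ k with hb
  have hkb : q ^ k ≤ b := Nat.le_mul_of_pos_left _ hd1
  have hsum : padicNorm q (harmonicSum r a b) < (q : ℚ) ^ k := by
    rw [padicNorm_harmonicSum_lt_iff r ha hak.le, hb, Nat.mul_div_cancel _ hqk]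
    have : harmonicSum (fun j => r (j * q ^ k)) 1 d = harmonicSum (fun j => r (j * q ^ f)) 1 d := by
      refine Finset.sum_congr rfl fun j hj => ?_
      simp only [hrk j (Finset.mem_Icc.mp hj).1]
    rw [this]
    exact h
  have hstep : harmonicSum r a b = harmonicSum r a (b - 1) + (r b : ℚ) / (b : ℕ) := by
    obtain ⟨c, hc⟩ : ∃ c, b = c + 1 := ⟨b - 1, by omega⟩
    rw [hc, harmonicSum, harmonicSum, Finset.sum_Icc_succ_top (by omega)]
    simp
  have hterm : padicNorm q ((r b : ℚ) / (b : ℕ)) = (q : ℚ) ^ k := by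
    have h1 : padicNorm q (r b) = 1 := by
      rw [padicNorm.int_eq_one_iff]
      intro hdvd
      have hne : r b ≠ 0 := by rw [hb, hrk d hd1]; exact hdne
      have h2 := Int.le_of_dvd (abs_pos.mpr hne) ((dvd_abs _ _).mpr hdvd)
      have h3 := hr b (by omega)
      omega
    have h2 : padicNorm q (d : ℚ) = 1 := by
      rw [padicNorm.nat_eq_one_iff]
      exact fun hdvd => by
        have := Nat.le_of_dvd hd1 hdvd
        omega
    rw [padicNorm.div, h1, hb]
    push_cast
    rw [padicNorm.mul, h2, padicNorm_natCast_prime_pow]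
    simp
  refine ⟨b, by omega, ?_, ?_⟩
  · calc b < q * q ^ k := Nat.mul_lt_mul_of_pos_right hdq hqk
      _ ≤ q * (q ^ t.totient * a) := Nat.mul_le_mul_left _ hka
      _ = q ^ (t.totient + 1) * a := by ring
      _ ≤ q ^ m * a := Nat.mul_le_mul_right _ (Nat.pow_le_pow_right hqp.pos (by omega))
  · rw [vab_eq_den r b ha, vab_eq_den r (b - 1) ha]
    refine Rat.den_lt_den_of_padicNorm_lt (q := q) (k := k) (d := d) (by omega) hd1 hdq hstep
      hsum ?_
    by_contra! hcon
    have h4 : (r b : ℚ) / (b : ℕ) = harmonicSum r a b - harmonicSum r a (b - 1) := by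
      rw [hstep]; ring
    rw [h4] at hterm
    exact absurd hterm (lt_of_le_of_lt padicNorm.sub (max_lt hsum hcon)).ne

lemma Nat.exists_prime_pow_dvd_of_forall_prime_le {u Z m : ℕ} (hu : u ≠ 0) (hZ : 1 ≤ Z)
    (hsm : ∀ q, q.Prime → q ∣ u → q ≤ m) (hlt : Z ^ (m - 1) < u) :
    ∃ q, q.Prime ∧ q ≤ m ∧ ∃ e, q ^ e ∣ u ∧ Z < q ^ e := by
  by_contra! hcon
  have hsub : u.primeFactors ⊆ Finset.Icc 2 m := fun q hq => by
    have hqp := Nat.prime_of_mem_primeFactors hq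
    exact Finset.mem_Icc.mpr ⟨hqp.two_le, hsm q hqp (Nat.dvd_of_mem_primeFactors hq)⟩
  have hcard : u.primeFactors.card ≤ m - 1 := by
    have := Finset.card_le_card hsub
    rw [Nat.card_Icc] at this
    omega
  have hle : u ≤ Z ^ (m - 1) := by
    calc u = ∏ q ∈ u.primeFactors, q ^ u.factorization q :=
          (Nat.prod_factorization_pow_eq_self hu).symm
      _ ≤ ∏ _q ∈ u.primeFactors, Z := by
          refine Finset.prod_le_prod' fun q hq => ?_
          have hqp := Nat.prime_of_mem_primeFactors hq
          exact hcon q hqp (hsm q hqp (Nat.dvd_of_mem_primeFactors hq)) _ (Nat.ordProj_dvd u q)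
      _ = Z ^ u.primeFactors.card := by simp
      _ ≤ Z ^ (m - 1) := Nat.pow_le_pow_right hZ hcard
  omega

/-- If `D` contains the full contribution to `lcm(1, …, n)` of every prime above `m`, then `D` is
at least `lcm(1, …, n)` up to a factor `n ^ (m - 1)`. -/
lemma Nat.lcmUpto_le_pow_mul_of_prime_pow_dvd {n m D : ℕ} (hn : 1 ≤ n) (hD : D ≠ 0)
    (h : ∀ q, q.Prime → m < q → q ≤ n → q ^ Nat.log q n ∣ D) :
    Nat.lcmUpto n ≤ n ^ (m - 1) * D := by
  rw [Nat.lcmUpto_eq_prod_pow_log, ← Finset.prod_filter_mul_prod_filter_not _ (fun q => q ≤ m)]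
  refine Nat.mul_le_mul ?_ (Nat.le_of_dvd (Nat.pos_of_ne_zero hD) ?_)
  · calc ∏ q ∈ (Nat.primesLE n).filter (· ≤ m), q ^ Nat.log q n
        ≤ ∏ _q ∈ (Nat.primesLE n).filter (· ≤ m), n :=
          Finset.prod_le_prod' fun q _ => Nat.pow_log_le_self q (by omega)
      _ = n ^ ((Nat.primesLE n).filter (· ≤ m)).card := by simp
      _ ≤ n ^ (m - 1) := by
          refine Nat.pow_le_pow_right hn ?_
          have hsub : (Nat.primesLE n).filter (· ≤ m) ⊆ Finset.Icc 2 m := fun q hq => by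
            rw [Finset.mem_filter] at hq
            exact Finset.mem_Icc.mpr ⟨Nat.two_le_of_mem_primesLE hq.1, hq.2⟩
          have := Finset.card_le_card hsub
          rw [Nat.card_Icc] at this
          omega
  · have hmem : ∀ q ∈ (Nat.primesLE n).filter (fun q => ¬ q ≤ m),
        q.Prime ∧ m < q ∧ q ≤ n := fun q hq => by
      rw [Finset.mem_filter, Nat.mem_primesLE] at hq
      exact ⟨hq.1.2, by omega, hq.1.1⟩
    refine Finset.prod_dvd_of_isRelPrime (fun p hp q hq hpq => ?_) fun q hq => ?_
    · have h1 := (hmem p (Finset.mem_coe.mp hp)).1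
      have h2 := (hmem q (Finset.mem_coe.mp hq)).1
      exact Nat.coprime_iff_isRelPrime.mp
        (Nat.Coprime.pow _ _ ((Nat.coprime_primes h1 h2).mpr hpq))
    · obtain ⟨h1, h2, h3⟩ := hmem q hq
      exact h q h1 h2 h3

lemma Rat.dvd_num_sub {x y : ℚ} {E : ℤ} (hx : E ∣ x.num) (hy : E ∣ y.num) : E ∣ (x - y).num := by
  have key : (x - y).num * (x.den * y.den) = (x.num * y.den - y.num * x.den) * (x - y).den := by
    rw [← mul_assoc, Rat.substr_num_den']
  have h1 : E ∣ (x - y).num * (x.den * y.den) := by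
    rw [key]
    exact (Dvd.dvd.sub (hx.mul_right _) (hy.mul_right _)).mul_right _
  have hcop : ∀ z : ℚ, E ∣ z.num → IsCoprime E (z.den : ℤ) := fun z hz =>
    (Int.isCoprime_iff_nat_coprime.mpr (by simpa using z.reduced)).of_isCoprime_of_dvd_left hz
  exact ((hcop x hx).mul_right (hcop y hy)).dvd_of_dvd_mul_right h1

lemma Rat.num_dvd_of_mul_eq {x : ℚ} {P A : ℤ} (h : x * P = A) : x.num ∣ A := by
  have hd : (x.den : ℚ) ≠ 0 := by exact_mod_cast x.den_nz
  have h1 : x.num * P = A * x.den := by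
    have : (x.num : ℚ) * P = A * x.den := by
      rw [← h]
      nth_rewrite 2 [← Rat.num_div_den x]
      field_simp
    exact_mod_cast this
  have hcop : IsCoprime x.num (x.den : ℤ) :=
    Int.isCoprime_iff_nat_coprime.mpr (by simpa using x.reduced)
  exact hcop.dvd_of_dvd_mul_right (Dvd.intro _ h1)

lemma abs_div_natCast_le {r : ℕ → ℤ} {m i : ℕ} (hr : ∀ i, 1 ≤ i → |r i| < m) (hi : 1 ≤ i) :
    |(r i : ℚ) / i| ≤ m := by
  have h1 : |(r i : ℚ)| ≤ m := by exact_mod_cast (hr i hi).le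
  have h2 : (1 : ℚ) ≤ i := by exact_mod_cast hi
  rw [abs_div, Nat.abs_cast, div_le_iff₀ (by linarith)]
  nlinarith [abs_nonneg (r i : ℚ)]

lemma harmonicSum_abs_le {r : ℕ → ℤ} {m a b : ℕ} (hr : ∀ i, 1 ≤ i → |r i| < m) (ha : 1 ≤ a) :
    |harmonicSum r a b| ≤ m * ((b + 1 - a : ℕ) : ℚ) := by
  calc |harmonicSum r a b| ≤ ∑ i ∈ Finset.Icc a b, |(r i : ℚ) / i| := Finset.abs_sum_le_sum_abs _ _
    _ ≤ ∑ _i ∈ Finset.Icc a b, (m : ℚ) :=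
        Finset.sum_le_sum fun i hi => abs_div_natCast_le hr (ha.trans (Finset.mem_Icc.mp hi).1)
    _ = _ := by simp [mul_comm]

/-- The numerator of a weighted harmonic sum divides a number of absolute value at most
`m (b + 1 - a) b ^ (b + 1 - a)`. -/
lemma natAbs_num_harmonicSum_le {r : ℕ → ℤ} {m a b : ℕ} (hr : ∀ i, 1 ≤ i → |r i| < m) (ha : 1 ≤ a)
    (h0 : harmonicSum r a b ≠ 0) :
    (harmonicSum r a b).num.natAbs ≤ m * (b + 1 - a) * b ^ (b + 1 - a) := by
  set x := harmonicSum r a b with hx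
  set P : ℕ := ∏ i ∈ Finset.Icc a b, i with hP
  have hPpos : 0 < P := Finset.prod_pos fun i hi => by
    have := (Finset.mem_Icc.mp hi).1
    omega
  obtain ⟨A, hA⟩ : ∃ A : ℤ, x * (P : ℤ) = A := by
    refine ⟨∑ i ∈ Finset.Icc a b, r i * ((∏ j ∈ (Finset.Icc a b).erase i, j : ℕ) : ℤ), ?_⟩
    rw [Int.cast_sum, hx, harmonicSum, Finset.sum_mul]
    refine Finset.sum_congr rfl fun i hi => ?_
    have hi0 : (i : ℚ) ≠ 0 := by
      have := (Finset.mem_Icc.mp hi).1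
      exact_mod_cast (by omega : i ≠ 0)
    have hPi : P = i * ∏ j ∈ (Finset.Icc a b).erase i, j :=
      (Finset.mul_prod_erase _ (fun j => j) hi).symm
    rw [hPi]
    push_cast
    field_simp
  have hA0 : A ≠ 0 := by
    rintro rfl
    rw [Int.cast_zero, mul_eq_zero] at hA
    rcases hA with hA | hA
    · exact h0 hA
    · exact hPpos.ne' (by exact_mod_cast hA)
  have hPle : P ≤ b ^ (b + 1 - a) := by
    calc P ≤ ∏ _i ∈ Finset.Icc a b, b :=
          Finset.prod_le_prod' fun i hi => (Finset.mem_Icc.mp hi).2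
      _ = _ := by simp
  have hAle : A.natAbs ≤ m * (b + 1 - a) * b ^ (b + 1 - a) := by
    have h1 : (A.natAbs : ℚ) = |x| * P := by
      rw [Nat.cast_natAbs, Int.cast_abs, ← hA, abs_mul]
      simp
    have h2 : (A.natAbs : ℚ) ≤ ((m * (b + 1 - a) * b ^ (b + 1 - a) : ℕ) : ℚ) := by
      rw [h1, Nat.cast_mul, Nat.cast_mul]
      exact mul_le_mul (harmonicSum_abs_le hr ha) (by exact_mod_cast hPle) (by positivity)
        (by positivity)
    exact_mod_cast h2
  exact (Nat.le_of_dvd (Int.natAbs_pos.mpr hA0)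
    (Int.natAbs_dvd_natAbs.mpr (Rat.num_dvd_of_mul_eq hA))).trans hAle

lemma harmonicSum_sub (r : ℕ → ℤ) {k n : ℕ} (hkn : k ≤ n) :
    harmonicSum r 1 n - harmonicSum r 1 k = harmonicSum r (k + 1) n := by
  induction n, hkn using Nat.le_induction with
  | base => simp [harmonicSum]
  | succ n hn ih =>
    unfold harmonicSum at ih ⊢
    rw [Finset.sum_Icc_succ_top (by omega), Finset.sum_Icc_succ_top (by omega), ← ih]
    ring

/-- Two distinct nearby initial sums cannot both have a numerator divisible by `E` if `E` is
large. -/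
lemma le_of_dvd_num_harmonicSum {r : ℕ → ℤ} {m k n N w E : ℕ} (hr : ∀ i, 1 ≤ i → |r i| < m)
    (hkn : k < n) (hnN : n ≤ N) (hw : n - k ≤ w)
    (hk : (E : ℤ) ∣ (harmonicSum r 1 k).num) (hn : (E : ℤ) ∣ (harmonicSum r 1 n).num)
    (hne : harmonicSum r 1 k ≠ harmonicSum r 1 n) : E ≤ m * w * N ^ w := by
  have hdvd := Rat.dvd_num_sub hn hk
  rw [harmonicSum_sub r hkn.le] at hdvd
  have h0 : harmonicSum r (k + 1) n ≠ 0 := by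
    rw [← harmonicSum_sub r hkn.le]
    exact sub_ne_zero.mpr hne.symm
  have h1 : E ≤ (harmonicSum r (k + 1) n).num.natAbs :=
    Nat.le_of_dvd (Int.natAbs_pos.mpr (Rat.num_ne_zero.mpr h0)) (Int.natCast_dvd.mp hdvd)
  refine h1.trans ((natAbs_num_harmonicSum_le hr (by omega) h0).trans ?_)
  have h2 : n + 1 - (k + 1) ≤ w := by omega
  have h3 : 1 ≤ N := by omega
  gcongr

lemma padicNorm_lt_one_of_dvd_num {q : ℕ} [Fact q.Prime] {x : ℚ} (h : (q : ℤ) ∣ x.num) :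
    padicNorm q x < 1 := by
  have hqp : q.Prime := Fact.out
  have hden : padicNorm q (x.den : ℚ) = 1 := by
    rw [padicNorm.nat_eq_one_iff]
    intro hd
    have := Nat.dvd_gcd (Int.natCast_dvd.mp h) hd
    rw [x.reduced] at this
    exact hqp.one_lt.ne' (Nat.dvd_one.mp this)
  rw [← Rat.num_div_den x, padicNorm.div, hden, div_one]
  exact (padicNorm.int_lt_one_iff _).mpr h

/-- If all primes above `m` contribute fully to the denominator of a weighted harmonic sum which is
not too small, then some prime power of a prime up to `m` dividing the numerator is large. -/
lemma exists_prime_pow_dvd_num_harmonicSum {r : ℕ → ℤ} {m n N y Z : ℕ}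
    (hr : ∀ i, 1 ≤ i → |r i| < m) (hmN : m ≤ N) (hn : 1 ≤ n) (hyn : y ≤ n) (hnN : n ≤ N)
    (hZ : 1 ≤ Z) (hA : 4 * N ^ 2 * N ^ (m - 1) * Z ^ (m - 1) < 2 ^ y)
    (hS : 1 ≤ 2 * N * |harmonicSum r 1 n|)
    (hW : ∀ q, q.Prime → m < q → q ≤ N ^ (N + 2) →
      (q : ℚ) ^ Nat.log q n ≤ padicNorm q (harmonicSum r 1 n)) :
    ∃ q, q.Prime ∧ q ≤ m ∧ ∃ e, ((q ^ e : ℕ) : ℤ) ∣ (harmonicSum r 1 n).num ∧ Z < q ^ e := by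
  set x := harmonicSum r 1 n with hx
  have hN : 1 ≤ N := by omega
  have hx0 : x ≠ 0 := by
    intro h
    rw [h] at hS
    norm_num at hS
  have hu0 : x.num.natAbs ≠ 0 := Int.natAbs_ne_zero.mpr (Rat.num_ne_zero.mpr hx0)
  have hule : x.num.natAbs ≤ N ^ (N + 2) := by
    refine (natAbs_num_harmonicSum_le hr le_rfl hx0).trans ?_
    rw [Nat.add_sub_cancel]
    calc m * n * n ^ n ≤ N * N * N ^ N := by
          have : n ^ n ≤ N ^ N := (Nat.pow_le_pow_left hnN n).trans (Nat.pow_le_pow_right hN hnN)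
          gcongr
      _ = _ := by ring
  have hlcm : Nat.lcmUpto n ≤ n ^ (m - 1) * x.den := by
    refine Nat.lcmUpto_le_pow_mul_of_prime_pow_dvd hn x.den_nz fun q hq hmq hqn => ?_
    have := Fact.mk hq
    rw [prime_pow_dvd_den_iff x (Nat.log_pos hq.one_lt hqn)]
    exact hW q hq hmq ((hqn.trans hnN).trans (Nat.le_self_pow (by omega) N))
  have hden : x.den ≤ 2 * N * x.num.natAbs := by
    have hd : (0 : ℚ) < x.den := by exact_mod_cast x.den_pos
    have h1 : |x| = x.num.natAbs / x.den := by
      conv_lhs => rw [← Rat.num_div_den x]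
      rw [abs_div, Nat.abs_cast, Nat.cast_natAbs, Int.cast_abs]
    rw [h1, ← mul_div_assoc, le_div_iff₀ hd, one_mul] at hS
    exact_mod_cast hS
  have hbig : Z ^ (m - 1) < x.num.natAbs := by
    have h1 : 2 ^ y ≤ 4 * N ^ 2 * N ^ (m - 1) * x.num.natAbs := by
      calc 2 ^ y ≤ 2 ^ n := Nat.pow_le_pow_right (by norm_num) hyn
        _ ≤ (n + 1) * Nat.lcmUpto n := Chebyshev.two_pow_le_mul_lcmUpto n
        _ ≤ (2 * N) * (N ^ (m - 1) * (2 * N * x.num.natAbs)) := by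
          refine Nat.mul_le_mul (by omega) (hlcm.trans ?_)
          gcongr
        _ = _ := by ring
    exact lt_of_mul_lt_mul_left (hA.trans_le h1) (Nat.zero_le _)
  obtain ⟨q, hq, hqm, e, he, hZe⟩ :=
    Nat.exists_prime_pow_dvd_of_forall_prime_le (m := m) hu0 hZ (fun q hq hqu => by
      by_contra! hmq
      have := Fact.mk hq
      have h1 := hW q hq hmq ((Nat.le_of_dvd (Nat.pos_of_ne_zero hu0) hqu).trans hule)
      have h2 := padicNorm_lt_one_of_dvd_num (Int.natCast_dvd.mpr hqu)
      have h3 : (1 : ℚ) ≤ (q : ℚ) ^ Nat.log q n := one_le_pow₀ (by exact_mod_cast hq.one_le)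
      linarith) hbig
  exact ⟨q, hq, hqm, e, Int.natCast_dvd.mpr he, hZe⟩

lemma padicNorm_harmonicSum_le_one {q : ℕ} [Fact q.Prime] (r : ℕ → ℤ) {n : ℕ} (h : n < q) :
    padicNorm q (harmonicSum r 1 n) ≤ 1 := by
  refine padicNorm.sum_le' (fun i hi => ?_) zero_le_one
  rw [Finset.mem_Icc] at hi
  have h1 : padicNorm q (i : ℚ) = 1 := by
    rw [padicNorm.nat_eq_one_iff]
    intro hd
    have := Nat.le_of_dvd hi.1 hd
    omega
  rw [padicNorm.div, h1, div_one]
  exact padicNorm.of_int _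

/-- Initial sums on opposite sides of a prime `q` are different when `q` contributes to the
denominator of the longer one. -/
lemma harmonicSum_ne_of_lt_prime {q : ℕ} (hq : q.Prime) (r : ℕ → ℤ) {k n : ℕ} (hk : k < q)
    (hn : q ≤ n) (h : (q : ℚ) ^ Nat.log q n ≤ padicNorm q (harmonicSum r 1 n)) :
    harmonicSum r 1 k ≠ harmonicSum r 1 n := by
  have := Fact.mk hq
  intro he
  have h1 := padicNorm_harmonicSum_le_one r hk
  rw [he] at h1
  have h2 : (1 : ℚ) < (q : ℚ) ^ Nat.log q n :=
    one_lt_pow₀ (by exact_mod_cast hq.one_lt) (Nat.log_pos hq.one_lt hn).ne'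
  linarith

lemma exists_padicNorm_harmonicSum_lt {r : ℕ → ℤ} {m N y w : ℕ}
    (hr : ∀ i, 1 ≤ i → |r i| < m) (hm : 2 ≤ m) (hrp : ∀ p, p.Prime → m < p → r p ≠ 0)
    (hmy : m ≤ y) (hw : 1 ≤ w)
    (hA : 4 * N ^ 2 * N ^ (m - 1) * (m * w * N ^ w) ^ (m - 1) < 2 ^ y)
    (hB : 2 * ((m - 1) * (N / w + 1)) + y < (Nat.primesLE N).card) :
    ∃ q n, q.Prime ∧ m < q ∧ q ≤ N ^ (N + 2) ∧ 1 ≤ n ∧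
      padicNorm q (harmonicSum r 1 n) < (q : ℚ) ^ Nat.log q n := by
  by_contra! hcon
  have hcard : ∀ k, (Nat.primesLE k).card ≤ k := fun k => by
    have hsub : Nat.primesLE k ⊆ Finset.Icc 1 k := fun p hp => Finset.mem_Icc.mpr
      ⟨(Nat.prime_of_mem_primesLE hp).one_le, Nat.le_of_mem_primesLE hp⟩
    simpa using Finset.card_le_card hsub
  have hyN : y < N := by
    have := hcard N
    omega
  have hZ : 1 ≤ m * w * N ^ w := by
    have : 0 < N := by omega
    exact Nat.succ_le_of_lt (by positivity)
  set P := (Nat.primesLE N).filter (y < ·) with hP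
  have hPmem : ∀ p ∈ P, p.Prime ∧ y < p ∧ p ≤ N := fun p hp => by
    rw [hP, Finset.mem_filter, Nat.mem_primesLE] at hp
    exact ⟨hp.1.2, hp.2, hp.1.1⟩
  have hPcard : 2 * ((m - 1) * (N / w + 1)) < P.card := by
    have h1 : P.card + ((Nat.primesLE N).filter (fun p => ¬ y < p)).card =
        (Nat.primesLE N).card := Finset.card_filter_add_card_filter_not _
    have h2 : (Nat.primesLE N).filter (fun p => ¬ y < p) ⊆ Nat.primesLE y := fun p hp => by
      rw [Finset.mem_filter, Nat.mem_primesLE] at hp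
      exact Nat.mem_primesLE.mpr ⟨by omega, hp.1.2⟩
    have h3 := (Finset.card_le_card h2).trans (hcard y)
    omega
  -- one of the two sums around each prime is not too small
  have hchoice : ∀ p ∈ P, ∃ s : Fin 2, ∃ q, q.Prime ∧ q ≤ m ∧ ∃ e,
      ((q ^ e : ℕ) : ℤ) ∣ (harmonicSum r 1 (p - s)).num ∧ m * w * N ^ w < q ^ e := by
    intro p hp
    obtain ⟨hpp, hyp, hpN⟩ := hPmem p hp
    have hsize : ∃ s : Fin 2, 1 ≤ 2 * N * |harmonicSum r 1 (p - s)| := by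
      by_contra! hsmall
      have h0 := hsmall 0
      have h1 := hsmall 1
      simp only [Fin.val_zero, Fin.val_one, Nat.sub_zero] at h0 h1
      have hdiff : harmonicSum r 1 p - harmonicSum r 1 (p - 1) = (r p : ℚ) / p := by
        rw [harmonicSum_sub r (by omega), Nat.sub_add_cancel hpp.one_le]
        simp [harmonicSum]
      have hp0 : (0 : ℚ) < p := by exact_mod_cast hpp.pos
      have habs : (1 : ℚ) ≤ N * |(r p : ℚ) / p| := by
        have h2 : (1 : ℚ) ≤ |(r p : ℚ)| := by
          exact_mod_cast Int.one_le_abs (hrp p hpp (by omega))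
        have h3 : (p : ℚ) ≤ N := by exact_mod_cast hpN
        rw [abs_div, Nat.abs_cast, ← mul_div_assoc, le_div_iff₀ hp0]
        nlinarith
      rw [← hdiff] at habs
      have htri := abs_sub (harmonicSum r 1 p) (harmonicSum r 1 (p - 1))
      have hN0 : (0 : ℚ) ≤ N := by positivity
      nlinarith [mul_le_mul_of_nonneg_left htri hN0]
    obtain ⟨s, hs⟩ := hsize
    have hs2 := s.isLt
    exact ⟨s, exists_prime_pow_dvd_num_harmonicSum hr (by omega) (by omega) (by omega) (by omega)
      hZ hA hs fun q hq hmq hqN => hcon q _ hq hmq hqN (by omega)⟩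
  choose! s q hq hqm e he hlarge using hchoice
  set holes : Finset (Fin 2 × ℕ × ℕ) :=
    Finset.univ ×ˢ (Finset.Icc 2 m ×ˢ Finset.range (N / w + 1)) with hholes
  have hholescard : holes.card < P.card := by
    rw [hholes, Finset.card_product, Finset.card_product, Finset.card_univ, Fintype.card_fin,
      Nat.card_Icc, Finset.card_range]
    have : m + 1 - 2 = m - 1 := by omega
    rwa [this]
  obtain ⟨p₁, hp₁, p₂, hp₂, hne, heq⟩ := Finset.exists_ne_map_eq_of_card_lt_of_maps_to
    (f := fun p => (s p, q p, p / w)) hholescard (fun p hp => by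
      have hp' := Finset.mem_coe.mp hp
      simp only [hholes, Finset.coe_product, Set.mem_prod, Finset.coe_univ, Set.mem_univ,
        Finset.coe_Icc, Set.mem_Icc, Finset.coe_range, Set.mem_Iio, true_and]
      exact ⟨⟨(hq p hp').two_le, hqm p hp'⟩,
        Nat.lt_succ_of_le (Nat.div_le_div_right (hPmem p hp').2.2)⟩)
  simp only [Prod.mk.injEq] at heq
  obtain ⟨hs, hqq, hdiv⟩ := heq
  wlog hlt : p₁ < p₂ generalizing p₁ p₂
  · exact this p₂ hp₂ p₁ hp₁ hne.symm hs.symm hqq.symm hdiv.symm (by omega)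
  obtain ⟨hp₁p, hyp₁, hp₁N⟩ := hPmem p₁ hp₁
  obtain ⟨hp₂p, hyp₂, hp₂N⟩ := hPmem p₂ hp₂
  have hNpow : N ≤ N ^ (N + 2) := Nat.le_self_pow (by omega) N
  have hclose : p₂ - p₁ ≤ w := by
    have h1 := Nat.div_add_mod p₁ w
    have h2 := Nat.div_add_mod p₂ w
    have h3 := Nat.mod_lt p₂ hw
    rw [hdiv] at h1
    omega
  have he₁ := he p₁ hp₁
  have he₂ := he p₂ hp₂
  have hl₁ := hlarge p₁ hp₁
  have hl₂ := hlarge p₂ hp₂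
  rw [hs, hqq] at he₁
  rw [hqq] at hl₁
  have hs2 := (s p₂).isLt
  set σ : ℕ := (s p₂ : ℕ) with hσ
  have hdistinct : harmonicSum r 1 (p₁ - σ) ≠ harmonicSum r 1 (p₂ - σ) := by
    rcases Nat.lt_or_ge 0 σ with h | h
    · exact harmonicSum_ne_of_lt_prime hp₁p r (by omega) (by omega)
        (hcon p₁ _ hp₁p (by omega) (by omega) (by omega))
    · exact harmonicSum_ne_of_lt_prime hp₂p r (by omega) (by omega)
        (hcon p₂ _ hp₂p (by omega) (by omega) (by omega))
  have hbound : q p₂ ^ min (e p₁) (e p₂) ≤ m * w * N ^ w := by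
    refine le_of_dvd_num_harmonicSum hr (k := p₁ - σ) (n := p₂ - σ) (by omega) (by omega)
      (by omega) (dvd_trans ?_ he₁) (dvd_trans ?_ he₂) hdistinct
    · exact Int.natCast_dvd_natCast.mpr (pow_dvd_pow _ (min_le_left _ _))
    · exact Int.natCast_dvd_natCast.mpr (pow_dvd_pow _ (min_le_right _ _))
  rcases min_choice (e p₁) (e p₂) with h | h <;> rw [h] at hbound <;> omega

lemma Nat.le_mul_card_primesLE_two_pow {K : ℕ} :
    2 ^ K ≤ K * ((Nat.primesLE (2 ^ K)).card + 1) + 1 := by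
  set N := 2 ^ K with hN
  have h1 : Nat.lcmUpto N ≤ N ^ (Nat.primesLE N).card := by
    rw [Nat.lcmUpto_eq_prod_pow_log]
    exact Finset.prod_le_pow_card _ _ _ fun p _ => Nat.pow_log_le_self p (by positivity)
  have h2 : N + 1 ≤ 2 ^ (K + 1) := by
    have := Nat.one_le_two_pow (n := K)
    rw [pow_succ]
    omega
  have h3 : 2 ^ N ≤ 2 ^ (K * ((Nat.primesLE N).card + 1) + 1) := by
    calc 2 ^ N ≤ (N + 1) * Nat.lcmUpto N := Chebyshev.two_pow_le_mul_lcmUpto N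
      _ ≤ 2 ^ (K + 1) * N ^ (Nat.primesLE N).card := Nat.mul_le_mul h2 h1
      _ = _ := by rw [hN, ← pow_mul, ← pow_add]; congr 1; ring
  exact (Nat.pow_le_pow_iff_right (by norm_num)).mp h3

lemma le_two_pow_three_mul_add {m : ℕ} (hm : 2 ≤ m) :
    32 * m ^ 2 * (3 * m + 16) ^ 3 ≤ 2 ^ (3 * m + 16) := by
  induction m, hm using Nat.le_induction with
  | base => norm_num
  | succ m hm ih =>
    have h1 : 4 * (m + 1) ^ 2 ≤ 9 * m ^ 2 := by nlinarith
    have h2 : 64 * (3 * (m + 1) + 16) ^ 3 ≤ 125 * (3 * m + 16) ^ 3 := by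
      calc 64 * (3 * (m + 1) + 16) ^ 3 = (4 * (3 * (m + 1) + 16)) ^ 3 := by ring
        _ ≤ (5 * (3 * m + 16)) ^ 3 := Nat.pow_le_pow_left (by omega) 3
        _ = _ := by ring
    have h3 := Nat.mul_le_mul h1 h2
    have h4 : 2 ^ (3 * (m + 1) + 16) = 8 * 2 ^ (3 * m + 16) := by
      rw [show 3 * (m + 1) + 16 = 3 + (3 * m + 16) by ring, pow_add]
      norm_num
    rw [h4]
    nlinarith

lemma le_two_pow_add_six {m : ℕ} (hm : 2 ≤ m) :
    m * (3 * m + 16) * 2 ≤ 2 ^ (m + 6) := by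
  induction m, hm using Nat.le_induction with
  | base => norm_num
  | succ m hm ih =>
    rw [show m + 1 + 6 = (m + 6) + 1 by ring, pow_succ]
    nlinarith

lemma exists_prime_padicNorm_harmonicSum_lt {r : ℕ → ℤ} {m : ℕ}
    (hr : ∀ i, 1 ≤ i → |r i| < m) (hm : 2 ≤ m) (hrp : ∀ p, p.Prime → m < p → r p ≠ 0) :
    ∃ q n, q.Prime ∧ m < q ∧ q ≤ 2 ^ ((3 * m + 16) * (2 ^ (3 * m + 16) + 2)) ∧ 1 ≤ n ∧
      padicNorm q (harmonicSum r 1 n) < (q : ℚ) ^ Nat.log q n := by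
  have hN := le_two_pow_three_mul_add hm
  have hcard := Nat.le_mul_card_primesLE_two_pow (K := 3 * m + 16)
  have hK : 22 ≤ 3 * m + 16 := by omega
  generalize 3 * m + 16 = K at hN hcard hK ⊢
  have hmwN : m * (8 * m * K) ≤ 2 ^ K := by
    refine le_trans ?_ hN
    calc m * (8 * m * K) = 8 * m ^ 2 * (K * 1) := by ring
      _ ≤ 32 * m ^ 2 * (K * K ^ 2) := by
        have : 1 ≤ K ^ 2 := Nat.one_le_pow _ _ (by omega)
        gcongr
        norm_num
      _ = _ := by ring
  obtain ⟨l, rfl⟩ : ∃ l, m = l + 1 := ⟨m - 1, by omega⟩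
  have hA : 4 * (2 ^ K) ^ 2 * (2 ^ K) ^ l *
      ((l + 1) * (8 * (l + 1) * K) * (2 ^ K) ^ (8 * (l + 1) * K)) ^ l
        < 2 ^ (8 * (l + 1) ^ 2 * K ^ 2) := by
    calc _ ≤ 2 ^ 2 * (2 ^ K) ^ 2 * (2 ^ K) ^ l * (2 ^ K * (2 ^ K) ^ (8 * (l + 1) * K)) ^ l := by
          gcongr
          norm_num
      _ = 2 ^ (2 + K * 2 + K * l + (K + K * (8 * (l + 1) * K)) * l) := by
          simp only [← pow_mul, ← pow_add]
      _ < _ := Nat.pow_lt_pow_right (by norm_num) (by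
        have h1 : (l + 1) * K * 22 ≤ (l + 1) * K * K := Nat.mul_le_mul_left _ hK
        have h2 : 0 < (l + 1) * K := by positivity
        nlinarith)
  have hB : 2 * (l * (2 ^ K / (8 * (l + 1) * K) + 1)) + 8 * (l + 1) ^ 2 * K ^ 2 <
      (Nat.primesLE (2 ^ K)).card := by
    generalize (Nat.primesLE (2 ^ K)).card = C at hcard
    have hdiv : 8 * (l + 1) * K * (2 ^ K / (8 * (l + 1) * K)) ≤ 2 ^ K := Nat.mul_div_le _ _
    generalize 2 ^ K / (8 * (l + 1) * K) = D at hdiv ⊢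
    generalize 2 ^ K = N at *
    by_contra! hC
    have h1 : K * (C + 1) + 1 ≤
        K * (2 * (l * (D + 1)) + 8 * (l + 1) ^ 2 * K ^ 2 + 1) + 1 := by gcongr
    have h2 : 4 * (K * (2 * (l * D))) ≤ N := by nlinarith [Nat.zero_le (K * D)]
    have h3 : K * (2 * l + 1) + 1 ≤ 2 * (l + 1) * K := by nlinarith
    have h4 : 2 * (l + 1) * K ≤ (l + 1) ^ 2 * K ^ 3 := by
      have h5 : 2 ≤ (l + 1) * K ^ 2 := by nlinarith
      calc 2 * (l + 1) * K = 2 * ((l + 1) * K) := by ring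
        _ ≤ (l + 1) * K ^ 2 * ((l + 1) * K) := by gcongr
        _ = _ := by ring
    have h5 : 0 < (l + 1) ^ 2 * K ^ 3 := by positivity
    nlinarith
  obtain ⟨q, n, hq, hmq, hqN, h⟩ := exists_padicNorm_harmonicSum_lt hr hm hrp
    (y := 8 * (l + 1) ^ 2 * K ^ 2) (w := 8 * (l + 1) * K) (N := 2 ^ K)
    (by nlinarith [Nat.zero_le l, Nat.one_le_pow 2 K (by omega)]) (by nlinarith) hA hB
  exact ⟨q, n, hq, hmq, hqN.trans_eq (pow_mul _ _ _).symm, h⟩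

lemma two_pow_lt_exp_exp {m : ℕ} (hm : 2 ≤ m) :
    (2 : ℝ) ^ ((3 * m + 16) * (2 ^ (3 * m + 16) + 2) * m) <
      Real.exp (Real.exp (m * (3 + 6 / Real.log m))) := by
  have hm' : (2 : ℝ) ≤ m := by exact_mod_cast hm
  have hlog : 0 < Real.log m := Real.log_pos (by linarith)
  have he := Real.exp_one_gt_d9
  have hlogle : Real.exp 1 * Real.log m ≤ m := by
    have h1 := Real.add_one_le_exp (Real.log m - 1)
    rw [Real.exp_sub, Real.exp_log (by linarith), sub_add_cancel,
      le_div_iff₀ (Real.exp_pos 1)] at h1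
    linarith
  have hE : ((3 * m + 16 : ℕ) : ℝ) ≤ m * (3 + 6 / Real.log m) := by
    have h1 : 16 ≤ m * 6 / Real.log m := by
      rw [le_div_iff₀ hlog]
      nlinarith
    push_cast
    rw [mul_add, ← mul_div_assoc]
    linarith
  have hexp : ((2 ^ (4 * m + 22) : ℕ) : ℝ) ≤ Real.exp ((3 * m + 16 : ℕ) : ℝ) := by
    have h1 : (2.7 : ℝ) ^ (3 * m + 16) ≤ Real.exp ((3 * m + 16 : ℕ) : ℝ) := by
      rw [← Real.exp_one_pow]
      gcongr
      linarith
    refine le_trans ?_ h1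
    push_cast
    rw [pow_add, pow_add, pow_mul, pow_mul]
    gcongr <;> norm_num
  have hcount : (3 * m + 16) * (2 ^ (3 * m + 16) + 2) * m ≤ 2 ^ (4 * m + 22) := by
    calc (3 * m + 16) * (2 ^ (3 * m + 16) + 2) * m
        ≤ (3 * m + 16) * (2 ^ (3 * m + 16) + 2 ^ (3 * m + 16)) * m := by
          gcongr
          exact Nat.le_self_pow (by omega) 2
      _ = (m * (3 * m + 16) * 2) * 2 ^ (3 * m + 16) := by ring
      _ ≤ 2 ^ (m + 6) * 2 ^ (3 * m + 16) := Nat.mul_le_mul_right _ (le_two_pow_add_six hm)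
      _ = _ := by rw [← pow_add]; congr 1; ring
  set M := (3 * m + 16) * (2 ^ (3 * m + 16) + 2) * m with hM
  have hM0 : M ≠ 0 := by positivity
  calc (2 : ℝ) ^ M < Real.exp 1 ^ M := pow_lt_pow_left₀ (by linarith) (by norm_num) hM0
    _ = Real.exp M := Real.exp_one_pow M
    _ ≤ _ := Real.exp_le_exp.mpr <| (Nat.cast_le.mpr hcount).trans <|
      hexp.trans (Real.exp_le_exp.mpr hE)

/-- If `r_i ≠ 0` whenever `gcd(i,t) = 1`, then with `m = 1 + max(r*, t)` and
`c = exp(exp(m(3 + 6/log m)))`, for every `a ≥ 1` there is `b` with `a < b < c·a`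
and `v_{a,b} < v_{a,b-1}`. -/
theorem exists_denominator_drop_linear_of_coprime_nonzero
    (t : ℕ) (r : ℕ → ℤ) (ht : 1 ≤ t)
    (hper : ∀ i, 1 ≤ i → r (i + t) = r i)
    (hnz : ∃ i, 1 ≤ i ∧ r i ≠ 0)
    (hcop : ∀ i, 1 ≤ i → Nat.Coprime i t → r i ≠ 0) :
    ∀ a : ℕ, 1 ≤ a →
      ∃ b : ℕ, a < b ∧
        (b : ℝ) < Real.exp (Real.exp ((1 + max (rstar r t) t : ℕ) *
          (3 + 6 / Real.log (1 + max (rstar r t) t : ℕ)))) * a ∧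
        vab r a b < vab r a (b - 1) := by
  intro a ha
  set m := 1 + max (rstar r t) t with hm
  have htm : t < m := by omega
  have hr : ∀ i, 1 ≤ i → |r i| < m := fun i hi =>
    (abs_le_rstar ht hper hi).trans_lt (by exact_mod_cast (by omega : rstar r t < m))
  have hm2 : 2 ≤ m := by omega
  obtain ⟨q, n, hq, hmq, hqle, hn, h⟩ := exists_prime_padicNorm_harmonicSum_lt hr hm2
    fun p hp hmp => hcop p hp.one_le <|
      Nat.coprime_of_lt_prime (by omega) (htm.trans hmp) hp
  have := Fact.mk hq
  obtain ⟨b, hab, hb, hv⟩ := exists_vab_lt_of_padicNorm_lt ht hper hcop hr htm hmq hn h ha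
  refine ⟨b, hab, ?_, hv⟩
  have ha0 : (0 : ℝ) < a := by exact_mod_cast ha
  have hb' : b < 2 ^ ((3 * m + 16) * (2 ^ (3 * m + 16) + 2) * m) * a := by
    rw [pow_mul]
    exact hb.trans_le (by gcongr)
  calc (b : ℝ) < 2 ^ ((3 * m + 16) * (2 ^ (3 * m + 16) + 2) * m) * a := by exact_mod_cast hb'
    _ < _ := mul_lt_mul_of_pos_right (two_pow_lt_exp_exp hm2) ha0
end
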